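/- arXiv:0707.1745 — 2 statements merged into one kernel-verified Lean document; each statement's English description precedes it below -/
import Mathlib

section
/- For v = 0 the positivity domain is all of (0,1): Q_0 = (0,1), i.e., for every q ∈ (0,1) and every x ∈ ℝ_q^+ the q-translation operator T_{q,x}^0 is positive. -/
open scoped BigOperators

noncomputable section

/-- Finite q-Pochhammer symbol `(a;q)_n = ∏_{i=0}^{n-1} (1 - a q^i)`. -/
def qPoch (a q : ℝ) (n : ℕ) : ℝ := ∏ i ∈ Finset.range n, (1 - a * q ^ i)

/-- Infinite q-Pochhammer symbol `(a;q)_∞ = ∏_{i=0}^{∞} (1 - a q^i)`. -/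
def qPochInf (a q : ℝ) : ℝ := ∏' i : ℕ, (1 - a * q ^ i)

/-- Normalized Hahn–Exton q-Bessel function `j_v(x,q²)`. -/
def jHE (q v x : ℝ) : ℝ :=
  ∑' n : ℕ, (-1 : ℝ) ^ n * q ^ (n * (n + 1)) * x ^ (2 * n) /
    (qPoch (q ^ 2) (q ^ 2) n * qPoch (q ^ (2 * v + 2)) (q ^ 2) n)

/-- Hahn–Exton q-Bessel function with base `p`:
`J_v(x,p) = (x^v/(p;p)_∞) Σ_{n} (-1)^n p^{n(n+1)/2} (p^{v+n+1};p)_∞ x^{2n}/(p;p)_n`.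
With `p = q²` this is `J_v(x,q²)`. -/
def JHE (p v x : ℝ) : ℝ :=
  (x ^ v / qPochInf p p) *
    ∑' n : ℕ, (-1 : ℝ) ^ n * p ^ (((n : ℝ) * ((n : ℝ) + 1)) / 2) *
      qPochInf (p ^ (v + (n : ℝ) + 1)) p * x ^ (2 * n) / qPoch p p n

/-- The constant `c_{q,v}`. -/
def cqv (q v : ℝ) : ℝ :=
  (1 / (1 - q)) * qPochInf (q ^ (2 * v + 2)) (q ^ 2) / qPochInf (q ^ 2) (q ^ 2)

/-- Jackson q-integral on `[0,∞)`: `∫_0^∞ f(x) d_q x = (1-q) Σ_{n∈ℤ} q^n f(q^n)`. -/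
def jackson (q : ℝ) (f : ℝ → ℝ) : ℝ := (1 - q) * ∑' n : ℤ, q ^ n * f (q ^ n)

/-- The q-lattice `ℝ_q^+ = {q^n : n ∈ ℤ}`. -/
def Rq (q : ℝ) : Set ℝ := {x | ∃ n : ℤ, x = q ^ n}

/-- Membership in `L_{q,1,v}`: the Jackson integral `∫_0^∞ |f(x)| x^{2v+1} d_q x`
converges (absolutely). -/
def memL1 (q v : ℝ) (f : ℝ → ℝ) : Prop :=
  Summable fun n : ℤ => q ^ n * |f (q ^ n)| * (q ^ n) ^ (2 * v + 1 : ℝ)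

/-- q-Bessel Fourier transform `F_{q,v}`. -/
def qFourier (q v : ℝ) (f : ℝ → ℝ) (x : ℝ) : ℝ :=
  cqv q v * jackson q fun t => f t * jHE q v (x * t) * t ^ (2 * v + 1 : ℝ)

/-- q-translation operator `T_{q,x}^v`. -/
def qTrans (q v x : ℝ) (f : ℝ → ℝ) (y : ℝ) : ℝ :=
  cqv q v * jackson q fun t =>
    qFourier q v f t * jHE q v (x * t) * jHE q v (y * t) * t ^ (2 * v + 1 : ℝ)

/-- The kernel `D_v(x,y,z)`. -/
def Dker (q v x y z : ℝ) : ℝ :=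
  (cqv q v) ^ 2 * jackson q fun t =>
    jHE q v (x * t) * jHE q v (y * t) * jHE q v (z * t) * t ^ (2 * v + 1 : ℝ)

/-- Positivity of the q-translation operator `T_{q,x}^v`. -/
def IsPosT (q v x : ℝ) : Prop :=
  ∀ f : ℝ → ℝ, memL1 q v f → (∀ y ∈ Rq q, 0 ≤ f y) → ∀ y ∈ Rq q, 0 ≤ qTrans q v x f y

/-- The positivity domain `Q_v`. -/
def Qset (v : ℝ) : Set ℝ :=
  {q | q ∈ Set.Ioo (0 : ℝ) 1 ∧ ∀ x ∈ Rq q, IsPosT q v x}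

/-- The kernel `E_{v,x}(q^m,q^z,q^k)`. -/
def Ekern (q v x : ℝ) (m z k : ℤ) : ℝ :=
  (1 / ((1 - q) ^ 2 * cqv q v * cqv q (x - v))) *
    q ^ (-(k : ℝ) * (x + 2) - (m : ℝ) * v - (z : ℝ) * (x - v)) *
    JHE (q ^ 2) ((z : ℝ) - (k : ℝ)) (q ^ (x - v + (m : ℝ) - (k : ℝ))) *
    JHE (q ^ 2) (v + (z : ℝ) - (k : ℝ)) (q ^ ((m : ℝ) - (k : ℝ)))

/-- The function `q ↦ ₁φ₁(0;q;q,q) = Σ_{n} (-1)^n q^{n(n+1)/2} q^n /((q;q)_n)²`. -/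
def phiQ (q : ℝ) : ℝ :=
  ∑' n : ℕ, (-1 : ℝ) ^ n * q ^ (((n : ℝ) * ((n : ℝ) + 1)) / 2) * q ^ n / (qPoch q q n) ^ 2

/-- The reciprocal `1/(p;p)_n`, extended by zero to negative integers. -/
def qRec (p : ℝ) (n : ℤ) : ℝ := if n < 0 then 0 else (qPoch p p n.toNat)⁻¹

/-- Taylor coefficients of Euler's product `(z;p)_∞`. -/
def qEul (p : ℝ) (n : ℕ) : ℝ := (-1) ^ n * p ^ n.choose 2 * qRec p n

/-- The `₁φ₁`-type series `Σ_u (-1)^u p^{u(u-1)/2} b^u / ((p;p)_u (p;p)_{u+k})`. -/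
def hahnSum (p b : ℝ) (k : ℤ) : ℝ := ∑' u : ℕ, qEul p u * b ^ u * qRec p (u + k)

/-- Laurent coefficients of `(z w;p)_∞ / (w;p)_∞` in `w`. -/
def ratioCoeff (p z : ℝ) (N : ℤ) : ℝ := ∑' v : ℕ, qEul p v * z ^ v * qRec p (N - v)

section Kernel

variable {p : ℝ}

lemma qPoch_self_pos (h0 : 0 < p) (h1 : p < 1) (n : ℕ) : 0 < qPoch p p n := by
  refine Finset.prod_pos fun i _ => ?_
  have := pow_lt_one₀ h0.le h1 (Nat.succ_ne_zero i)
  rw [pow_succ'] at this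
  linarith

lemma qPoch_self_succ (n : ℕ) : qPoch p p (n + 1) = qPoch p p n * (1 - p ^ (n + 1)) := by
  simp [qPoch, Finset.prod_range_succ, pow_succ']

lemma qRec_neg {n : ℤ} (hn : n < 0) : qRec p n = 0 := if_pos hn

lemma qRec_natCast (n : ℕ) : qRec p n = (qPoch p p n)⁻¹ := by simp [qRec]

@[simp] lemma qRec_zero : qRec p 0 = 1 := by simp [qRec, qPoch]

lemma qRec_nonneg (h0 : 0 < p) (h1 : p < 1) (n : ℤ) : 0 ≤ qRec p n := by
  unfold qRec
  split_ifs
  · exact le_rfl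
  · exact inv_nonneg.2 (qPoch_self_pos h0 h1 _).le

lemma qRec_natCast_pos (h0 : 0 < p) (h1 : p < 1) (n : ℕ) : 0 < qRec p n := by
  rw [qRec_natCast]
  exact inv_pos.2 (qPoch_self_pos h0 h1 _)

lemma one_sub_mul_qRec_succ (h0 : 0 < p) (h1 : p < 1) (n : ℕ) :
    (1 - p ^ (n + 1)) * qRec p (n + 1 : ℕ) = qRec p n := by
  have h := (qPoch_self_pos h0 h1 (n + 1)).ne'
  have h' := (qPoch_self_pos h0 h1 n).ne'
  rw [qRec_natCast, qRec_natCast]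
  rw [qPoch_self_succ] at h ⊢
  have := right_ne_zero_of_mul h
  field_simp

lemma one_sub_mul_qRec (h0 : 0 < p) (h1 : p < 1) (n : ℤ) :
    (1 - p ^ n) * qRec p n = qRec p (n - 1) := by
  rcases lt_trichotomy n 0 with h | rfl | h
  · rw [qRec_neg h, qRec_neg (by omega), mul_zero]
  · rw [qRec_neg (by omega : (0 : ℤ) - 1 < 0)]
    simp
  · obtain ⟨m, rfl⟩ : ∃ m : ℕ, n = (m + 1 : ℕ) := ⟨(n - 1).toNat, by omega⟩
    have := one_sub_mul_qRec_succ h0 h1 m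
    rw [zpow_natCast, this]
    congr 1
    push_cast
    ring

lemma exists_qRec_le (h0 : 0 < p) (h1 : p < 1) : ∃ F : ℝ, 0 ≤ F ∧ ∀ n, qRec p n ≤ F := by
  have key : ∀ n : ℕ, qRec p n ≤ Real.exp ((∑ i ∈ Finset.range n, p ^ i) / (1 - p)) := by
    intro n
    induction n with
    | zero => simp
    | succ n ih =>
      have hlt : p ^ (n + 1) < 1 := pow_lt_one₀ h0.le h1 (Nat.succ_ne_zero n)
      have hle : p ^ (n + 1) ≤ p := by
        simpa using pow_le_pow_of_le_one h0.le h1.le (Nat.succ_le_succ (Nat.zero_le n))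
      have hle' : p ^ (n + 1) ≤ p ^ n := pow_le_pow_of_le_one h0.le h1.le (Nat.le_succ n)
      have hpos : 0 < 1 - p ^ (n + 1) := by linarith
      have e : qRec p (n + 1 : ℕ) = qRec p n * (1 - p ^ (n + 1))⁻¹ := by
        rw [← one_sub_mul_qRec_succ h0 h1 n]
        field_simp
      rw [e, Finset.sum_range_succ, add_div, Real.exp_add]
      refine mul_le_mul ih ?_ (inv_nonneg.2 hpos.le) (Real.exp_pos _).le
      refine le_trans ?_ (Real.add_one_le_exp _)
      have h2 : p ^ (n + 1) / (1 - p ^ (n + 1)) ≤ p ^ n / (1 - p) :=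
        div_le_div₀ (by positivity) hle' (by linarith) (by linarith)
      refine le_trans (le_of_eq ?_) (add_le_add_left h2 1)
      field_simp
      ring
  refine ⟨Real.exp ((1 - p)⁻¹ / (1 - p)), (Real.exp_pos _).le, fun n => ?_⟩
  rcases lt_or_ge n 0 with h | h
  · rw [qRec_neg h]
    exact (Real.exp_pos _).le
  · lift n to ℕ using h
    refine (key n).trans (Real.exp_le_exp.2 ?_)
    have : ∑ i ∈ Finset.range n, p ^ i ≤ (1 - p)⁻¹ := by
      rw [← tsum_geometric_of_lt_one h0.le h1]
      exact (summable_geometric_of_lt_one h0.le h1).sum_le_tsum _ fun i _ => by positivity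
    have hp : 0 < 1 - p := by linarith
    gcongr

@[simp] lemma qEul_zero : qEul p 0 = 1 := by simp [qEul]

lemma one_sub_mul_qEul_succ (h0 : 0 < p) (h1 : p < 1) (n : ℕ) :
    (1 - p ^ (n + 1)) * qEul p (n + 1) = -(p ^ n * qEul p n) := by
  have := one_sub_mul_qRec_succ h0 h1 n
  unfold qEul
  rw [Nat.choose_succ_succ' n 1, Nat.choose_one_right, pow_add, ← this]
  ring

lemma qEul_ne_zero (h0 : 0 < p) (h1 : p < 1) (n : ℕ) : qEul p n ≠ 0 := by
  have := (qRec_natCast_pos h0 h1 n).ne'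
  unfold qEul
  positivity

lemma summable_norm_qEul_mul_pow (h0 : 0 < p) (h1 : p < 1) {z : ℝ} (hz : 0 < z) :
    Summable fun n => ‖qEul p n * z ^ n‖ := by
  refine Summable.norm (summable_of_ratio_test_tendsto_lt_one (l := 0) one_pos ?_ ?_)
  · exact Filter.Eventually.of_forall fun n =>
      mul_ne_zero (qEul_ne_zero h0 h1 n) (pow_ne_zero _ hz.ne')
  · have e : ∀ n, ‖qEul p (n + 1) * z ^ (n + 1)‖ / ‖qEul p n * z ^ n‖
        = p ^ n * z / (1 - p ^ (n + 1)) := by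
      intro n
      have hlt : p ^ (n + 1) < 1 := pow_lt_one₀ h0.le h1 (Nat.succ_ne_zero n)
      have hpos : 0 < 1 - p ^ (n + 1) := by linarith
      have e1 : qEul p (n + 1) * z ^ (n + 1)
          = -(p ^ n * z / (1 - p ^ (n + 1))) * (qEul p n * z ^ n) := by
        have := one_sub_mul_qEul_succ h0 h1 n
        field_simp
        rw [pow_succ]
        linear_combination z ^ n * z * this
      have h3 : ‖qEul p n * z ^ n‖ ≠ 0 :=
        norm_ne_zero_iff.2 (mul_ne_zero (qEul_ne_zero h0 h1 n) (pow_ne_zero _ hz.ne'))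
      rw [e1, norm_mul, mul_div_cancel_right₀ _ h3, norm_neg, Real.norm_eq_abs,
        abs_of_nonneg (by positivity)]
    simp_rw [e]
    have t := tendsto_pow_atTop_nhds_zero_of_lt_one h0.le h1
    have t' := (Filter.tendsto_add_atTop_iff_nat 1).2 t
    have := (t.mul_const z).div (tendsto_const_nhds.sub t') (by norm_num : (1 : ℝ) - 0 ≠ 0)
    rwa [zero_mul, zero_div] at this

lemma summable_qEul_mul_qRec (h0 : 0 < p) (h1 : p < 1) {z : ℝ} (hz : 0 < z) (s : ℕ → ℤ) :
    Summable fun u : ℕ => qEul p u * z ^ u * qRec p (s u) := by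
  obtain ⟨F, hF0, hF⟩ := exists_qRec_le h0 h1
  refine Summable.of_norm_bounded ((summable_norm_qEul_mul_pow h0 h1 hz).mul_right F) fun u => ?_
  rw [norm_mul, Real.norm_of_nonneg (qRec_nonneg h0 h1 (s u))]
  gcongr
  exact hF _

lemma ratioCoeff_of_neg (z : ℝ) {N : ℤ} (hN : N < 0) : ratioCoeff p z N = 0 := by
  unfold ratioCoeff
  rw [← tsum_zero (α := ℝ) (β := ℕ)]
  exact tsum_congr fun v => by rw [qRec_neg (by omega), mul_zero]

lemma ratioCoeff_zero (z : ℝ) : ratioCoeff p z 0 = 1 := by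
  unfold ratioCoeff
  rw [tsum_eq_single 0]
  · simp
  · intro v hv
    rw [qRec_neg (by omega), mul_zero]

lemma one_sub_mul_ratioCoeff (h0 : 0 < p) (h1 : p < 1) {z : ℝ} (hz : 0 < z) (N : ℤ) :
    (1 - p ^ N) * ratioCoeff p z N = (1 - z) * ratioCoeff p (p * z) (N - 1) := by
  have hC := (summable_qEul_mul_qRec h0 h1 (mul_pos h0 hz) fun v => N - 1 - v).hasSum
  have hR := (summable_qEul_mul_qRec h0 h1 hz fun v => N - v).hasSum.mul_left (1 - p ^ N)
  set A : ℕ → ℝ := fun v => (1 - p ^ v) * (qEul p v * z ^ v * qRec p (N - v)) with hA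
  have hA1 : HasSum A (-z * ratioCoeff p (p * z) (N - 1)) := by
    have : HasSum (fun v => A (v + 1)) (-z * ratioCoeff p (p * z) (N - 1)) := by
      refine (hC.mul_left (-z)).congr_fun ?_
      intro v
      have e := one_sub_mul_qEul_succ h0 h1 v
      have e2 : N - ((v + 1 : ℕ) : ℤ) = N - 1 - v := by push_cast; ring
      simp only [hA, e2, mul_pow]
      linear_combination z ^ (v + 1) * qRec p (N - 1 - v) * e
    simpa [hA] using (hasSum_nat_add_iff 1).1 this
  have h := hA1.add hC
  have h' := hR.unique (h.congr_fun fun v => ?_)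
  · refine h'.trans ?_
    change _ + ratioCoeff p (p * z) (N - 1) = _
    ring
  · have e := one_sub_mul_qRec h0 h1 (N - v)
    have e2 : N - 1 - (v : ℤ) = N - v - 1 := by ring
    have e3 : p ^ N = p ^ v * p ^ (N - v) := by
      rw [← zpow_natCast p v, ← zpow_add₀ h0.ne']
      congr 1
      ring
    simp only [hA, e2, mul_pow]
    rw [← e, e3]
    ring

lemma ratioCoeff_inv_pow (h0 : 0 < p) (h1 : p < 1) (i N : ℕ) :
    ratioCoeff p (p ^ i)⁻¹ N
      = qPoch p p i * qEul p N * qRec p (i - N) * ((p ^ i)⁻¹) ^ N := by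
  have hlt : ∀ n : ℕ, 1 - p ^ (n + 1) ≠ 0 := fun n =>
    (sub_pos.2 (pow_lt_one₀ h0.le h1 (Nat.succ_ne_zero n))).ne'
  have h00 : ∀ i : ℕ, qPoch p p i * qRec p i = 1 := fun i => by
    rw [qRec_natCast, mul_inv_cancel₀ (qPoch_self_pos h0 h1 i).ne']
  induction i generalizing N with
  | zero =>
    cases N with
    | zero => simp [ratioCoeff_zero, qPoch]
    | succ N =>
      have e := one_sub_mul_ratioCoeff h0 h1 (z := 1) one_pos ((N + 1 : ℕ) : ℤ)
      rw [sub_self, zero_mul, zpow_natCast] at e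
      have e' := (mul_eq_zero.1 e).resolve_left (hlt N)
      rw [qRec_neg (by omega)]
      simpa using e'
  | succ i ih =>
    cases N with
    | zero => simpa [ratioCoeff_zero] using (h00 (i + 1)).symm
    | succ N =>
      have hz : 0 < (p ^ (i + 1))⁻¹ := by positivity
      have e := one_sub_mul_ratioCoeff h0 h1 hz ((N + 1 : ℕ) : ℤ)
      have e1 : p * (p ^ (i + 1))⁻¹ = (p ^ i)⁻¹ := by
        rw [pow_succ' p i]
        field_simp
      have e2 : ((N + 1 : ℕ) : ℤ) - 1 = N := by push_cast; ring
      have e3 : ((i + 1 : ℕ) : ℤ) - ((N + 1 : ℕ) : ℤ) = i - N := by push_cast; ring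
      rw [e1, e2, ih, zpow_natCast] at e
      refine mul_left_cancel₀ (hlt N) (e.trans ?_)
      rw [e3, qPoch_self_succ]
      have e4 := one_sub_mul_qEul_succ h0 h1 N
      have e5 : ((p ^ (i + 1))⁻¹) ^ (N + 1) * p ^ N = ((p ^ i)⁻¹) ^ N * (p ^ (i + 1))⁻¹ := by
        rw [pow_succ ((p ^ (i + 1))⁻¹), pow_succ p i, mul_inv, mul_pow, inv_pow p N]
        field_simp
      have e6 : p ^ (i + 1) * (p ^ (i + 1))⁻¹ = 1 := mul_inv_cancel₀ (by positivity)
      linear_combination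
        (-(qPoch p p i * (1 - p ^ (i + 1)) * qRec p (i - N) * ((p ^ (i + 1))⁻¹) ^ (N + 1))) * e4
        + qPoch p p i * qEul p N * qRec p (i - N) * (1 - p ^ (i + 1)) * e5
        - qPoch p p i * qEul p N * qRec p (i - N) * ((p ^ i)⁻¹) ^ N * e6

lemma hasSum_tsum_mul_tsum {f g : ℕ → ℝ} (hf : Summable f) (hg : Summable g) :
    HasSum (fun y : ℕ × ℕ => f y.1 * g y.2) ((∑' u, f u) * ∑' v, g v) :=
  hf.hasSum.mul hg.hasSum (summable_mul_of_summable_norm hf.norm hg.norm)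

lemma hasSum_qEul_mul_qRec_mul (h0 : 0 < p) (h1 : p < 1) {x : ℝ} (hx : 0 < x) (s s' : ℕ → ℤ) :
    HasSum (fun y : ℕ × ℕ => (qEul p y.1 * x ^ y.1 * qRec p (s y.1)) *
        (qEul p y.2 * x ^ y.2 * qRec p (s' y.2)))
      ((∑' u : ℕ, qEul p u * x ^ u * qRec p (s u)) *
        ∑' v : ℕ, qEul p v * x ^ v * qRec p (s' v)) :=
  hasSum_tsum_mul_tsum (summable_qEul_mul_qRec h0 h1 hx s) (summable_qEul_mul_qRec h0 h1 hx s')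

lemma summable_int_of_eq_zero_of_neg {f : ℤ → ℝ} (hf : ∀ N < 0, f N = 0)
    (h : Summable fun n : ℕ => f n) : Summable f := by
  refine ((Nat.cast_injective (R := ℤ)).summable_iff fun N hN => hf N ?_).1 h
  by_contra hneg
  exact hN ⟨N.toNat, by omega⟩

/-- The general term of the triple series that rearranges the convolution of two `hahnSum`s. -/
def convTerm (p β z : ℝ) (m : ℤ) (x : ℤ × ℕ × ℕ) : ℝ :=
  β ^ x.1 * ((qEul p x.2.1 * z ^ x.2.1 * qRec p (x.1 + m - x.2.1)) *
    (qEul p x.2.2 * z ^ x.2.2 * qRec p (x.1 - x.2.2)))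

lemma norm_convTerm_le (h0 : 0 < p) (h1 : p < 1) {β z F : ℝ} (hβ0 : 0 < β)
    (hF0 : 0 ≤ F) (hF : ∀ n, qRec p n ≤ F) (m N : ℤ) (u v : ℕ) :
    ‖convTerm p β z m (N, u, v)‖ ≤ (if N < 0 then 0 else F ^ 2 * β ^ N) *
      (‖qEul p u * z ^ u‖ * ‖qEul p v * z ^ v‖) := by
  unfold convTerm
  dsimp only
  split_ifs with hN
  · rw [qRec_neg (by omega : N - (v : ℤ) < 0)]
    simp
  · have a1 := hF (N + m - u)
    have a2 := hF (N - v)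
    have b1 := qRec_nonneg h0 h1 (N + m - u)
    have b2 := qRec_nonneg h0 h1 (N - v)
    have hle : qRec p (N + m - u) * qRec p (N - v) ≤ F ^ 2 := by
      rw [sq]
      exact mul_le_mul a1 a2 b2 hF0
    rw [norm_mul, norm_mul, norm_mul (_ * _) (qRec p _), norm_mul (_ * _) (qRec p _),
      Real.norm_of_nonneg b1, Real.norm_of_nonneg b2, Real.norm_of_nonneg (zpow_pos hβ0 N).le]
    calc _ = (qRec p (N + m - u) * qRec p (N - v)) * (β ^ N *
          (‖qEul p u * z ^ u‖ * ‖qEul p v * z ^ v‖)) := by ring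
      _ ≤ F ^ 2 * (β ^ N * (‖qEul p u * z ^ u‖ * ‖qEul p v * z ^ v‖)) := by
          have := zpow_pos hβ0 N
          exact mul_le_mul_of_nonneg_right hle (by positivity)
      _ = _ := by ring

lemma summable_convTerm (h0 : 0 < p) (h1 : p < 1) {β z : ℝ} (hβ0 : 0 < β) (hβ1 : β < 1)
    (hz0 : 0 < z) (m : ℤ) : Summable (convTerm p β z m) := by
  obtain ⟨F, hF0, hF⟩ := exists_qRec_le h0 h1
  have hE := summable_norm_qEul_mul_pow h0 h1 hz0
  have hEE := hE.mul_of_nonneg hE (fun _ => norm_nonneg _) fun _ => norm_nonneg _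
  have hgeo : Summable fun N : ℤ => if N < 0 then 0 else F ^ 2 * β ^ N := by
    refine summable_int_of_eq_zero_of_neg (fun N hN => if_pos hN) ?_
    refine ((summable_geometric_of_lt_one hβ0.le hβ1).mul_left (F ^ 2)).congr fun N => ?_
    simp
  have hprod := hgeo.mul_of_nonneg hEE
    (fun N => by simp only [Pi.zero_apply]; split_ifs <;> positivity)
    fun x => mul_nonneg (norm_nonneg _) (norm_nonneg _)
  exact Summable.of_norm_bounded hprod fun ⟨N, u, v⟩ =>
    norm_convTerm_le h0 h1 hβ0 hF0 hF m N u v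

/-- The shear `(k, u, v) ↦ (k + u + v, u, v)`. -/
def shearEquiv : ℤ × ℕ × ℕ ≃ ℤ × ℕ × ℕ where
  toFun x := (x.1 + x.2.1 + x.2.2, x.2)
  invFun x := (x.1 - x.2.1 - x.2.2, x.2)
  left_inv x := Prod.ext (by ring) rfl
  right_inv x := Prod.ext (by ring) rfl

lemma convTerm_shearEquiv {β b : ℝ} (hβ0 : 0 < β) (m k : ℤ) (u v : ℕ) :
    convTerm p β (b / β) m (shearEquiv (k, u, v)) = β ^ k *
      ((qEul p u * b ^ u * qRec p (u + k)) * (qEul p v * b ^ v * qRec p (v + (k + m)))) := by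
  have s1 : k + u + v + m - (u : ℤ) = v + (k + m) := by ring
  have s2 : k + u + v - (v : ℤ) = u + k := by ring
  simp only [convTerm, shearEquiv, Equiv.coe_fn_mk]
  rw [s1, s2, zpow_add₀ hβ0.ne', zpow_add₀ hβ0.ne', zpow_natCast, zpow_natCast, div_pow, div_pow]
  field_simp

lemma hasSum_zpow_mul_hahnSum_mul (h0 : 0 < p) (h1 : p < 1) {β b : ℝ} (hβ0 : 0 < β)
    (hβ1 : β < 1) (hb : 0 < b) (m : ℤ) :
    HasSum (fun k : ℤ => β ^ k * (hahnSum p b k * hahnSum p b (k + m)))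
      (∑' N : ℤ, β ^ N * (ratioCoeff p (b / β) (N + m) * ratioCoeff p (b / β) N)) := by
  have hz0 : 0 < b / β := div_pos hb hβ0
  have hS := (summable_convTerm h0 h1 hβ0 hβ1 hz0 m).hasSum
  have hN : HasSum (fun N : ℤ => β ^ N * (ratioCoeff p (b / β) (N + m) * ratioCoeff p (b / β) N))
      (∑' x, convTerm p β (b / β) m x) := hS.prod_fiberwise fun N =>
    (hasSum_qEul_mul_qRec_mul h0 h1 hz0 (fun u => N + m - u) fun v => N - v).mul_left (β ^ N)
  rw [hN.tsum_eq]
  refine (shearEquiv.hasSum_iff.2 hS).prod_fiberwise fun k => ?_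
  refine ((hasSum_qEul_mul_qRec_mul h0 h1 hb (fun u => u + k) fun v => v + (k + m)).mul_left
    (β ^ k)).congr_fun ?_
  rintro ⟨u, v⟩
  exact convTerm_shearEquiv hβ0 m k u v

lemma summable_zpow_mul_hahnSum (h0 : 0 < p) (h1 : p < 1) {b : ℝ} (hb0 : 0 < b) (hb1 : b < 1) :
    Summable fun k : ℤ => b ^ k * hahnSum p b k := by
  obtain ⟨F, hF0, hF⟩ := exists_qRec_le h0 h1
  have hE := summable_norm_qEul_mul_pow h0 h1 one_pos
  have hgeo : Summable fun N : ℤ => b ^ N * qRec p N := by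
    refine summable_int_of_eq_zero_of_neg (fun N hN => by rw [qRec_neg hN, mul_zero]) ?_
    · refine Summable.of_nonneg_of_le (fun N => ?_) (fun N => ?_)
        ((summable_geometric_of_lt_one hb0.le hb1).mul_right F)
      · exact mul_nonneg (zpow_pos hb0 _).le (qRec_nonneg h0 h1 _)
      · simp only [zpow_natCast]
        gcongr
        exact hF _
  have hS := summable_mul_of_summable_norm hgeo.norm hE
  let e : ℤ × ℕ ≃ ℤ × ℕ :=
    { toFun := fun x => (x.1 + x.2, x.2)
      invFun := fun x => (x.1 - x.2, x.2)
      left_inv := fun x => by ext <;> simp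
      right_inv := fun x => by ext <;> simp }
  refine ((e.summable_iff.2 hS).prod).congr fun k => ?_
  unfold hahnSum
  rw [← tsum_mul_left]
  refine tsum_congr fun u => ?_
  simp only [e, Function.comp, Equiv.coe_fn_mk, one_pow, mul_one]
  rw [zpow_add₀ hb0.ne', zpow_natCast, add_comm k]
  ring

lemma exists_abs_hahnSum_le (h0 : 0 < p) (h1 : p < 1) {b : ℝ} (hb0 : 0 < b) :
    ∃ M : ℝ, 0 ≤ M ∧ ∀ k, |hahnSum p b k| ≤ M := by
  obtain ⟨F, hF0, hF⟩ := exists_qRec_le h0 h1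
  have hE := summable_norm_qEul_mul_pow h0 h1 hb0
  refine ⟨(∑' u, ‖qEul p u * b ^ u‖) * F,
    mul_nonneg (tsum_nonneg fun _ => norm_nonneg _) hF0, fun k => ?_⟩
  rw [← Real.norm_eq_abs]
  refine tsum_of_norm_bounded (hE.hasSum.mul_right F) fun u => ?_
  rw [norm_mul, Real.norm_of_nonneg (qRec_nonneg h0 h1 _)]
  gcongr
  exact hF _

/-- Euler's series for `(p^{n+1};p)_∞`. -/
def eulerSum (p : ℝ) (n : ℤ) : ℝ := ∑' r : ℕ, qEul p r * (p ^ (n + 1)) ^ r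

/-- Coefficients of the Hahn–Exton function of order zero, as a power series in `x²`. -/
def besselCoeff (p : ℝ) (i : ℕ) : ℝ := qEul p i * p ^ i * qRec p i

lemma eulerSum_sub_one (h0 : 0 < p) (h1 : p < 1) (n : ℤ) :
    eulerSum p (n - 1) = (1 - p ^ n) * eulerSum p n := by
  have hz : 0 < p ^ n := zpow_pos h0 n
  have hw : p ^ (n + 1) = p * p ^ n := by rw [zpow_add_one₀ h0.ne', mul_comm]
  have hC : HasSum (fun r => qEul p r * (p ^ (n + 1)) ^ r) (eulerSum p n) :=
    (summable_norm_qEul_mul_pow h0 h1 (zpow_pos h0 (n + 1))).of_norm.hasSum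
  have hR : HasSum (fun r => qEul p r * (p ^ n) ^ r) (eulerSum p (n - 1)) := by
    unfold eulerSum
    rw [sub_add_cancel]
    exact (summable_norm_qEul_mul_pow h0 h1 hz).of_norm.hasSum
  have hA : HasSum (fun r => (1 - p ^ r) * (qEul p r * (p ^ n) ^ r)) (-p ^ n * eulerSum p n) := by
    have : HasSum (fun r => (1 - p ^ (r + 1)) * (qEul p (r + 1) * (p ^ n) ^ (r + 1)))
        (-p ^ n * eulerSum p n) := by
      refine (hC.mul_left (-p ^ n)).congr_fun fun r => ?_
      rw [hw, mul_pow]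
      linear_combination (p ^ n) ^ (r + 1) * one_sub_mul_qEul_succ h0 h1 r
    simpa using (hasSum_nat_add_iff (f := fun r => (1 - p ^ r) * (qEul p r * (p ^ n) ^ r)) 1).1 this
  have h := hR.unique ((hA.add hC).congr_fun fun r => ?_)
  · rw [h]
    ring
  · rw [hw, mul_pow]
    ring

lemma eulerSum_eq (h0 : 0 < p) (h1 : p < 1) (n : ℤ) : eulerSum p n = eulerSum p 0 * qRec p n := by
  rcases lt_or_ge n 0 with h | h
  · rw [qRec_neg h, mul_zero]
    obtain ⟨m, rfl⟩ : ∃ m : ℕ, n = -m - 1 := ⟨(-n - 1).toNat, by omega⟩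
    clear h
    induction m with
    | zero => simpa using eulerSum_sub_one h0 h1 0
    | succ m ih =>
      have := eulerSum_sub_one h0 h1 (-m - 1)
      rw [ih, mul_zero] at this
      rw [← this]
      congr 1
      push_cast
      ring
  · lift n to ℕ using h
    induction n with
    | zero => simp
    | succ n ih =>
      have hlt : 1 - p ^ (n + 1) ≠ 0 :=
        (sub_pos.2 (pow_lt_one₀ h0.le h1 (Nat.succ_ne_zero n))).ne'
      have e := eulerSum_sub_one h0 h1 ((n + 1 : ℕ) : ℤ)
      rw [zpow_natCast, show ((n + 1 : ℕ) : ℤ) - 1 = n by push_cast; ring, ih,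
        ← one_sub_mul_qRec_succ h0 h1 n] at e
      refine mul_left_cancel₀ hlt (e.symm.trans ?_)
      ring

lemma eulerSum_zero_ne_zero (h0 : 0 < p) (h1 : p < 1) : eulerSum p 0 ≠ 0 := by
  intro hC
  have hlim : Filter.Tendsto (fun n : ℕ => eulerSum p n) Filter.atTop
      (nhds (∑' r : ℕ, if r = 0 then 1 else 0)) := by
    refine tendsto_tsum_of_dominated_convergence (summable_norm_qEul_mul_pow h0 h1 one_pos) ?_ ?_
    · intro r
      rcases Nat.eq_zero_or_pos r with rfl | hr
      · simp
      · rw [if_neg hr.ne']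
        have t : Filter.Tendsto (fun n : ℕ => p ^ ((n : ℤ) + 1)) Filter.atTop (nhds 0) := by
          have := (Filter.tendsto_add_atTop_iff_nat 1).2
            (tendsto_pow_atTop_nhds_zero_of_lt_one h0.le h1)
          exact_mod_cast this
        simpa [hr.ne'] using (t.pow r).const_mul (qEul p r)
    · refine Filter.Eventually.of_forall fun n r => ?_
      rw [norm_mul, norm_mul, one_pow, norm_one]
      refine mul_le_mul_of_nonneg_left ?_ (norm_nonneg _)
      rw [Real.norm_of_nonneg (by positivity)]
      refine pow_le_one₀ (by positivity) ?_
      exact_mod_cast pow_le_one₀ h0.le h1.le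
  have hzero : (fun n : ℕ => eulerSum p n) = fun _ => 0 := by
    funext n
    rw [eulerSum_eq h0 h1, hC, zero_mul]
  rw [hzero, tsum_ite_eq] at hlim
  exact one_ne_zero (tendsto_nhds_unique hlim tendsto_const_nhds)

lemma summable_norm_besselCoeff_mul_pow (h0 : 0 < p) (h1 : p < 1) {X : ℝ} (hX : 0 < X) :
    Summable fun i => ‖besselCoeff p i * X ^ i‖ := by
  refine ((summable_qEul_mul_qRec h0 h1 (mul_pos h0 hX) fun u => u).congr fun i => ?_).norm
  rw [besselCoeff, mul_pow]
  ring

lemma tsum_besselCoeff_mul_zpow (h0 : 0 < p) (h1 : p < 1) (k : ℤ) :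
    ∑' i, besselCoeff p i * (p ^ k) ^ i = hahnSum p p k := by
  refine mul_left_cancel₀ (eulerSum_zero_ne_zero h0 h1) ?_
  unfold hahnSum
  rw [← tsum_mul_left, ← tsum_mul_left]
  have hk : 0 < p ^ (k + 1) := zpow_pos h0 _
  have e1 : ∀ i : ℕ, eulerSum p 0 * (besselCoeff p i * (p ^ k) ^ i)
      = ∑' r : ℕ, qEul p i * (p ^ (k + 1)) ^ i * (qEul p r * p ^ r) * (p ^ r) ^ i := by
    intro i
    have := eulerSum_eq h0 h1 i
    calc _ = qEul p i * (p ^ (k + 1)) ^ i * (eulerSum p 0 * qRec p i) := by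
          rw [besselCoeff, zpow_add_one₀ h0.ne', mul_pow]
          ring
      _ = _ := by
          rw [← this, eulerSum, ← tsum_mul_left]
          refine tsum_congr fun r => ?_
          rw [zpow_add_one₀ h0.ne' (i : ℤ), zpow_natCast, mul_pow, ← pow_mul, ← pow_mul, mul_comm i r]
          ring
  have e2 : ∀ r : ℕ, eulerSum p 0 * (qEul p r * p ^ r * qRec p (r + k))
      = ∑' i : ℕ, qEul p i * (p ^ (k + 1)) ^ i * (qEul p r * p ^ r) * (p ^ r) ^ i := by
    intro r
    have := eulerSum_eq h0 h1 (r + k)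
    calc _ = qEul p r * p ^ r * (eulerSum p 0 * qRec p (r + k)) := by ring
      _ = _ := by
          rw [← this, eulerSum, ← tsum_mul_left]
          refine tsum_congr fun i => ?_
          rw [add_assoc, zpow_add₀ h0.ne', zpow_natCast, mul_pow]
          ring
  simp_rw [e1, e2]
  refine Summable.tsum_comm ?_
  refine Summable.of_norm_bounded ((summable_norm_qEul_mul_pow h0 h1 h0).mul_of_nonneg
    (summable_norm_qEul_mul_pow h0 h1 hk) (fun _ => norm_nonneg _) fun _ => norm_nonneg _) ?_
  rintro ⟨r, i⟩
  dsimp only [Function.uncurry]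
  rw [norm_mul, norm_mul (qEul p i * _), mul_comm ‖qEul p i * _‖]
  refine mul_le_of_le_one_right (by positivity) ?_
  rw [Real.norm_of_nonneg (by positivity)]
  exact pow_le_one₀ (by positivity) (pow_le_one₀ h0.le h1.le)

/-- Orthogonality of the Hahn–Exton functions of order zero. -/
lemma hasSum_hahnSum_orthogonality (h0 : 0 < p) (h1 : p < 1) (m : ℤ) :
    HasSum (fun k : ℤ => p ^ k * (hahnSum p p k * hahnSum p p (k + m)))
      (if m = 0 then 1 else 0) := by
  have hR : ∀ N : ℤ, ratioCoeff p 1 N = if N = 0 then 1 else 0 := by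
    intro N
    split_ifs with h
    · rw [h, ratioCoeff_zero]
    · rcases lt_or_ge N 0 with hN | hN
      · exact ratioCoeff_of_neg 1 hN
      · lift N to ℕ using hN
        have := ratioCoeff_inv_pow h0 h1 0 N
        rw [qRec_neg (by omega)] at this
        simpa using this
  have h := hasSum_zpow_mul_hahnSum_mul h0 h1 h0 h1 h0 m
  rw [div_self h0.ne', tsum_eq_single 0] at h
  · simpa [hR] using h
  · intro N hN
    rw [hR N, if_neg hN]
    simp

lemma hasSum_moment (h0 : 0 < p) (h1 : p < 1) (a i : ℕ) :
    HasSum (fun k : ℤ => (p ^ (a + 1 + i)) ^ k * hahnSum p (p ^ (a + 1)) k ^ 2)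
      (∑ N ∈ Finset.range (i + 1), (p ^ (a + 1 + i)) ^ N *
        (qPoch p p i * qEul p N * qRec p (i - N) * ((p ^ i)⁻¹) ^ N) ^ 2) := by
  have hβ1 : p ^ (a + 1 + i) < 1 := pow_lt_one₀ h0.le h1 (by omega)
  have h := hasSum_zpow_mul_hahnSum_mul h0 h1 (pow_pos h0 (a + 1 + i)) hβ1 (pow_pos h0 (a + 1)) 0
  have hz : p ^ (a + 1) / p ^ (a + 1 + i) = (p ^ i)⁻¹ := by
    rw [pow_add p (a + 1) i]
    field_simp
  simp only [hz, add_zero, ← sq] at h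
  convert h using 1
  rw [← (Nat.cast_injective (R := ℤ)).tsum_eq, tsum_eq_sum (s := Finset.range (i + 1))]
  · refine Finset.sum_congr rfl fun N _ => ?_
    rw [ratioCoeff_inv_pow h0 h1, zpow_natCast]
  · intro N hN
    rw [Finset.mem_range] at hN
    rw [ratioCoeff_inv_pow h0 h1, qRec_neg (by omega)]
    simp
  · intro N hN
    by_contra hneg
    refine hN ?_
    have : N < 0 := by
      by_contra h'
      exact hneg ⟨N.toNat, by omega⟩
    simp [ratioCoeff_of_neg _ this]

lemma besselCoeff_mul_moment_term (h0 : 0 < p) (h1 : p < 1) (a N l : ℕ) :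
    besselCoeff p (N + l) * ((p ^ (a + 1 + (N + l))) ^ N *
        (qPoch p p (N + l) * qEul p N * qRec p l * ((p ^ (N + l))⁻¹) ^ N) ^ 2)
      = besselCoeff p N * (p ^ a) ^ N * besselCoeff p l := by
  have e1 : ∀ n : ℕ, n.choose 2 + n.choose 2 + n = n ^ 2 := by
    intro n
    induction n with
    | zero => rfl
    | succ n ih =>
      rw [Nat.choose_succ_succ' n 1, Nat.choose_one_right]
      nlinarith
  have e2 : (N + l).choose 2 = N.choose 2 + l.choose 2 + N * l := by
    have := e1 (N + l)
    have := e1 N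
    have := e1 l
    nlinarith
  have e3 : qPoch p p (N + l) * qRec p ((N + l : ℕ) : ℤ) = 1 := by
    rw [qRec_natCast, mul_inv_cancel₀ (qPoch_self_pos h0 h1 _).ne']
  have e4 : (p ^ N.choose 2) ^ 2 * p ^ N = p ^ (N * N) := by
    rw [← pow_mul, ← pow_add, ← sq N, ← e1 N]
    congr 1
    ring
  have e5 : (p ^ (N + l)) ^ N * ((p ^ (N + l))⁻¹) ^ N = 1 := by
    rw [← mul_pow, mul_inv_cancel₀ (by positivity), one_pow]
  have e6 : p ^ (N * N) * p ^ (N * l) * ((p ^ (N + l))⁻¹) ^ N = 1 := by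
    rw [← e5, ← pow_mul]
    ring
  have e7 : ((-1 : ℝ) ^ N) ^ 2 = 1 := by rw [← pow_mul, mul_comm, pow_mul]; simp
  set P := qPoch p p (N + l)
  set Q := qRec p ((N + l : ℕ) : ℤ)
  set I := ((p ^ (N + l))⁻¹) ^ N
  have e8 : (p ^ (a + 1 + (N + l))) ^ N = (p ^ a) ^ N * p ^ N * (p ^ (N + l)) ^ N := by
    rw [pow_add, pow_succ, mul_pow, mul_pow]
  calc _ = ((-1) ^ (N + l) * p ^ (N + l) * (p ^ N.choose 2 * p ^ l.choose 2 * p ^ (N * l)) * Q * Q)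
        * (((p ^ a) ^ N * p ^ N * (p ^ (N + l)) ^ N) *
        (P * ((-1) ^ N * p ^ N.choose 2 * qRec p N) * qRec p l * I) ^ 2) := by
        rw [e8]
        unfold besselCoeff qEul
        rw [e2, pow_add p (_ + _), pow_add p (N.choose 2)]
        ring
    _ = (P * Q) ^ 2 * ((-1) ^ N) ^ 2 * ((p ^ (N + l)) ^ N * I) *
        (((p ^ N.choose 2) ^ 2 * p ^ N) * p ^ (N * l) * I) *
        ((-1) ^ (N + l) * p ^ (N + l) * (p ^ N.choose 2 * p ^ l.choose 2) * (p ^ a) ^ N *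
          qRec p N ^ 2 * qRec p l ^ 2) := by ring
    _ = _ := by
        rw [e3, e4, e5, e6, e7]
        unfold besselCoeff qEul
        ring

/-- The coefficient identity behind the product formula. -/
lemma besselCoeff_mul_moment (h0 : 0 < p) (h1 : p < 1) (a i : ℕ) :
    HasSum (fun k : ℤ => besselCoeff p i *
        ((p ^ (a + 1)) ^ k * hahnSum p (p ^ (a + 1)) k ^ 2 * (p ^ k) ^ i))
      (∑ N ∈ Finset.range (i + 1), besselCoeff p N * (p ^ a) ^ N * besselCoeff p (i - N)) := by
  have h := (hasSum_moment h0 h1 a i).mul_left (besselCoeff p i)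
  rw [Finset.mul_sum] at h
  have hval : ∀ N ∈ Finset.range (i + 1), besselCoeff p i * ((p ^ (a + 1 + i)) ^ N *
      (qPoch p p i * qEul p N * qRec p (i - N) * ((p ^ i)⁻¹) ^ N) ^ 2)
      = besselCoeff p N * (p ^ a) ^ N * besselCoeff p (i - N) := by
    intro N hN
    obtain ⟨l, rfl⟩ := Nat.exists_eq_add_of_le (Nat.lt_succ_iff.1 (Finset.mem_range.1 hN))
    have e : ((N + l : ℕ) : ℤ) - N = l := by push_cast; ring
    rw [e, besselCoeff_mul_moment_term h0 h1, Nat.add_sub_cancel_left]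
  rw [Finset.sum_congr rfl hval] at h
  refine h.congr_fun fun k => ?_
  rw [pow_add p (a + 1) i, mul_zpow, ← zpow_natCast (p ^ k) i, ← zpow_natCast p i,
    ← zpow_mul p k, ← zpow_mul p i, mul_comm k]
  ring

/-- Product formula for the Hahn–Exton function of order zero. -/
lemma hasSum_product_formula (h0 : 0 < p) (h1 : p < 1) (a : ℕ) (n : ℤ) :
    HasSum (fun k : ℤ => (p ^ (a + 1)) ^ k * hahnSum p (p ^ (a + 1)) k ^ 2 * hahnSum p p (n + k))
      (hahnSum p p (n + a) * hahnSum p p n) := by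
  set w : ℤ → ℝ := fun k => (p ^ (a + 1)) ^ k * hahnSum p (p ^ (a + 1)) k ^ 2 with hw
  have hw0 : ∀ k, 0 ≤ w k := fun k =>
    mul_nonneg (zpow_pos (pow_pos h0 _) k).le (sq_nonneg _)
  set X := p ^ n
  have hX : 0 < X := zpow_pos h0 n
  have hf := summable_norm_besselCoeff_mul_pow h0 h1 (mul_pos (pow_pos h0 a) hX)
  have hg := summable_norm_besselCoeff_mul_pow h0 h1 hX
  have hrow : ∀ i : ℕ, HasSum (fun k : ℤ => besselCoeff p i * X ^ i * (w k * (p ^ k) ^ i))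
      (∑ N ∈ Finset.range (i + 1), (besselCoeff p N * (p ^ a * X) ^ N) *
        (besselCoeff p (i - N) * X ^ (i - N))) := by
    intro i
    have h := (besselCoeff_mul_moment h0 h1 a i).mul_left (X ^ i)
    rw [Finset.mul_sum] at h
    have hval : ∀ N ∈ Finset.range (i + 1),
        X ^ i * (besselCoeff p N * (p ^ a) ^ N * besselCoeff p (i - N))
        = (besselCoeff p N * (p ^ a * X) ^ N) * (besselCoeff p (i - N) * X ^ (i - N)) := by
      intro N hN
      have e : X ^ i = X ^ N * X ^ (i - N) := by
        rw [← pow_add]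
        congr 1
        have := Finset.mem_range.1 hN
        omega
      rw [e, mul_pow]
      ring
    rw [Finset.sum_congr rfl hval] at h
    refine h.congr_fun fun k => ?_
    simp only [hw]
    ring
  have hS : Summable fun x : ℕ × ℤ => besselCoeff p x.1 * X ^ x.1 * (w x.2 * (p ^ x.2) ^ x.1) := by
    refine Summable.of_norm ?_
    have hnorm : ∀ (i : ℕ) (k : ℤ), ‖besselCoeff p i * X ^ i * (w k * (p ^ k) ^ i)‖
        = ‖besselCoeff p i * X ^ i‖ * (w k * (p ^ k) ^ i) := by
      intro i k
      rw [norm_mul, Real.norm_of_nonneg (mul_nonneg (hw0 k) (pow_pos (zpow_pos h0 k) i).le)]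
    refine (summable_prod_of_nonneg fun x => norm_nonneg _).2
      ⟨fun i => (hrow i).summable.norm, ?_⟩
    refine (summable_norm_sum_mul_range_of_summable_norm hf hg).congr fun i => ?_
    rw [← (hrow i).tsum_eq]
    simp_rw [hnorm]
    rw [tsum_mul_left, tsum_mul_left, norm_mul,
      Real.norm_of_nonneg (tsum_nonneg fun k =>
        mul_nonneg (hw0 k) (pow_pos (zpow_pos h0 k) i).le)]
  have hi := hS.hasSum.prod_fiberwise hrow
  have htot : ∑' x : ℕ × ℤ, besselCoeff p x.1 * X ^ x.1 * (w x.2 * (p ^ x.2) ^ x.1)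
      = hahnSum p p (n + a) * hahnSum p p n := by
    rw [← hi.tsum_eq, ← tsum_mul_tsum_eq_tsum_sum_range_of_summable_norm hf hg,
      ← tsum_besselCoeff_mul_zpow h0 h1, ← tsum_besselCoeff_mul_zpow h0 h1,
      zpow_add₀ h0.ne', zpow_natCast, mul_comm (p ^ a)]
  rw [← htot]
  refine ((Equiv.prodComm ℤ ℕ).hasSum_iff.2 hS.hasSum).prod_fiberwise fun k => ?_
  have h := (summable_norm_besselCoeff_mul_pow h0 h1 (zpow_pos h0 (n + k))).of_norm.hasSum
  rw [tsum_besselCoeff_mul_zpow h0 h1] at h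
  refine (h.mul_left (w k)).congr_fun fun i => ?_
  simp only [Function.comp, Equiv.prodComm_apply, Prod.swap_prod_mk]
  rw [zpow_add₀ h0.ne', mul_pow]
  ring

lemma summable_zpow_mul_hahnSum_add (h0 : 0 < p) (h1 : p < 1) (z : ℤ) :
    Summable fun n : ℤ => p ^ n * hahnSum p p (n + z) := by
  have h := ((Equiv.addRight z).summable_iff.2 (summable_zpow_mul_hahnSum h0 h1 h0 h1)).mul_left
    (p ^ (-z))
  refine h.congr fun n => ?_
  simp only [Function.comp, Equiv.coe_addRight]
  rw [zpow_add₀ h0.ne', zpow_neg]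
  have := (zpow_pos h0 z).ne'
  field_simp

lemma hasSum_zpow_mul_hahnSum_add_mul (h0 : 0 < p) (h1 : p < 1) (z z' : ℤ) :
    HasSum (fun n : ℤ => p ^ n * (hahnSum p p (n + z) * hahnSum p p (n + z')))
      (p ^ (-z) * if z' = z then 1 else 0) := by
  have h := ((Equiv.addRight z).hasSum_iff.2
    (hasSum_hahnSum_orthogonality h0 h1 (z' - z))).mul_left (p ^ (-z))
  simp only [sub_eq_zero] at h
  refine h.congr_fun fun n => ?_
  simp only [Function.comp, Equiv.coe_addRight]
  rw [zpow_add₀ h0.ne', zpow_neg, show n + z + (z' - z) = n + z' by ring]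
  have := (zpow_pos h0 z).ne'
  field_simp

/-- Nonnegativity of the triple-product kernel of order zero. -/
lemma tsum_hahnSum_triple_nonneg (h0 : 0 < p) (h1 : p < 1) (x y z : ℤ) :
    0 ≤ ∑' n : ℤ, p ^ n * (hahnSum p p (n + x) * hahnSum p p (n + y)) * hahnSum p p (n + z) := by
  wlog hxy : x ≤ y generalizing x y
  · have := this y x (by omega)
    simpa only [mul_comm (hahnSum p p (_ + y))] using this
  obtain ⟨a, rfl⟩ := Int.le.dest hxy
  obtain ⟨M, hM0, hM⟩ := exists_abs_hahnSum_le h0 h1 h0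
  set w : ℤ → ℝ := fun k => (p ^ (a + 1)) ^ k * hahnSum p (p ^ (a + 1)) k ^ 2 with hw
  have hw0 : ∀ k, 0 ≤ w k := fun k =>
    mul_nonneg (zpow_pos (pow_pos h0 _) k).le (sq_nonneg _)
  have hwS : Summable w := (hasSum_moment h0 h1 a 0).summable
  have hz := summable_zpow_mul_hahnSum_add h0 h1 z
  have hS : Summable fun v : ℤ × ℤ =>
      p ^ v.1 * hahnSum p p (v.1 + z) * (w v.2 * hahnSum p p (v.1 + x + v.2)) := by
    refine Summable.of_norm_bounded (hz.norm.mul_of_nonneg (hwS.mul_right M)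
      (fun _ => norm_nonneg _) fun k => mul_nonneg (hw0 k) hM0) ?_
    rintro ⟨n, k⟩
    rw [norm_mul, norm_mul (w k), Real.norm_of_nonneg (hw0 k)]
    exact mul_le_mul_of_nonneg_left (mul_le_mul_of_nonneg_left (hM _) (hw0 k)) (norm_nonneg _)
  have hn := hS.hasSum.prod_fiberwise fun n =>
    (hasSum_product_formula h0 h1 a (n + x)).mul_left (p ^ n * hahnSum p p (n + z))
  have hk := ((Equiv.prodComm ℤ ℤ).hasSum_iff.2 hS.hasSum).prod_fiberwise fun k =>
    ((hasSum_zpow_mul_hahnSum_add_mul h0 h1 z (x + k)).mul_left (w k)).congr_fun fun n => by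
      simp only [Function.comp, Equiv.prodComm_apply, Prod.swap_prod_mk, add_assoc]
      ring
  have hval : ∑' n : ℤ, p ^ n * (hahnSum p p (n + x) * hahnSum p p (n + (x + a)))
      * hahnSum p p (n + z) = ∑' k : ℤ, w k * (p ^ (-z) * if x + k = z then 1 else 0) := by
    rw [hk.tsum_eq, ← hn.tsum_eq]
    refine tsum_congr fun n => ?_
    rw [add_assoc n x]
    ring
  rw [hval]
  refine tsum_nonneg fun k => mul_nonneg (hw0 k) (mul_nonneg (zpow_pos h0 _).le ?_)
  split_ifs <;> norm_num

/-- The double series defining the translation is nonnegative on nonnegative sequences. -/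
lemma tsum_translation_nonneg (h0 : 0 < p) (h1 : p < 1) (x y : ℤ) {g : ℤ → ℝ}
    (hg0 : ∀ z, 0 ≤ g z) (hg : Summable g) :
    0 ≤ ∑' n : ℤ, p ^ n * (hahnSum p p (n + x) * hahnSum p p (n + y)) *
      ∑' z : ℤ, g z * hahnSum p p (n + z) := by
  obtain ⟨M, hM0, hM⟩ := exists_abs_hahnSum_le h0 h1 h0
  have hA : Summable fun n : ℤ => p ^ n * (hahnSum p p (n + x) * hahnSum p p (n + y)) :=
    (hasSum_zpow_mul_hahnSum_add_mul h0 h1 x y).summable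
  have hgM : ∀ n z : ℤ, ‖g z * hahnSum p p (n + z)‖ ≤ g z * M := fun n z => by
    rw [norm_mul, Real.norm_of_nonneg (hg0 z)]
    exact mul_le_mul_of_nonneg_left (hM _) (hg0 z)
  have hS : Summable fun v : ℤ × ℤ =>
      p ^ v.1 * (hahnSum p p (v.1 + x) * hahnSum p p (v.1 + y)) *
        (g v.2 * hahnSum p p (v.1 + v.2)) := by
    refine Summable.of_norm_bounded (hA.norm.mul_of_nonneg (hg.mul_right M)
      (fun _ => norm_nonneg _) fun k => mul_nonneg (hg0 k) hM0) ?_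
    rintro ⟨n, z⟩
    rw [norm_mul]
    exact mul_le_mul_of_nonneg_left (hgM n z) (norm_nonneg _)
  have hn := hS.hasSum.prod_fiberwise fun n =>
    (Summable.of_norm_bounded (hg.mul_right M) (hgM n)).hasSum.mul_left
      (p ^ n * (hahnSum p p (n + x) * hahnSum p p (n + y)))
  have hS' := (Equiv.prodComm ℤ ℤ).summable_iff.2 hS
  rw [hn.tsum_eq, ← (Equiv.prodComm ℤ ℤ).tsum_eq]
  refine le_of_le_of_eq (tsum_nonneg fun z => ?_) hS'.tsum_prod.symm
  have := mul_nonneg (hg0 z) (tsum_hahnSum_triple_nonneg h0 h1 x y z)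
  rw [← tsum_mul_left] at this
  refine this.trans_eq (tsum_congr fun n => ?_)
  simp only [Function.comp, Equiv.prodComm_apply, Prod.swap_prod_mk]
  ring

end Kernel

lemma jHE_zero_zpow {q : ℝ} (h0 : 0 < q) (h1 : q < 1) (k : ℤ) :
    jHE q 0 (q ^ k) = hahnSum (q ^ 2) (q ^ 2) k := by
  have hp0 : 0 < q ^ 2 := pow_pos h0 2
  have hp1 : q ^ 2 < 1 := pow_lt_one₀ h0.le h1 two_ne_zero
  rw [← tsum_besselCoeff_mul_zpow hp0 hp1, jHE]
  refine tsum_congr fun n => ?_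
  have e : q ^ (2 * (0 : ℝ) + 2) = q ^ 2 := by norm_num
  have e1 : (q ^ 2) ^ n.choose 2 * (q ^ 2) ^ n = q ^ (n * (n + 1)) := by
    rw [← pow_add, ← pow_mul]
    congr 1
    induction n with
    | zero => rfl
    | succ n ih =>
      rw [Nat.choose_succ_succ' n 1, Nat.choose_one_right]
      nlinarith
  have e2 : ((q ^ 2) ^ k) ^ n = (q ^ k) ^ (2 * n) := by
    rw [pow_mul (q ^ k), ← zpow_natCast q 2, ← zpow_natCast (q ^ k) 2, ← zpow_mul, ← zpow_mul,
      mul_comm k]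
  rw [e, ← e1, ← e2, besselCoeff, qEul, qRec_natCast]
  have := (qPoch_self_pos hp0 hp1 n).ne'
  field_simp

lemma zpow_mul_mul_rpow {q : ℝ} (n : ℤ) (c : ℝ) :
    q ^ n * (c * (q ^ n) ^ (2 * (0 : ℝ) + 1)) = (q ^ 2) ^ n * c := by
  have e : (q ^ n) ^ (2 * (0 : ℝ) + 1) = q ^ n := by norm_num
  rw [e, sq, mul_zpow]
  ring

lemma isPosT_zero {q : ℝ} (h0 : 0 < q) (h1 : q < 1) (x : ℤ) : IsPosT q 0 (q ^ x) := by
  rintro f hf hf0 _ ⟨y, rfl⟩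
  have hp0 : 0 < q ^ 2 := pow_pos h0 2
  have hp1 : q ^ 2 < 1 := pow_lt_one₀ h0.le h1 two_ne_zero
  have hj : ∀ m n : ℤ, jHE q 0 (q ^ m * q ^ n) = hahnSum (q ^ 2) (q ^ 2) (m + n) := fun m n => by
    rw [← zpow_add₀ h0.ne', jHE_zero_zpow h0 h1]
  have hf0' : ∀ z : ℤ, 0 ≤ f (q ^ z) := fun z => hf0 _ ⟨z, rfl⟩
  have hg : Summable fun z : ℤ => (q ^ 2) ^ z * f (q ^ z) := by
    refine Summable.congr hf fun z => ?_
    rw [abs_of_nonneg (hf0' z), mul_assoc, zpow_mul_mul_rpow]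
  have hF : ∀ n : ℤ, qFourier q 0 f (q ^ n) = cqv q 0 * ((1 - q) *
      ∑' z : ℤ, (q ^ 2) ^ z * f (q ^ z) * hahnSum (q ^ 2) (q ^ 2) (n + z)) := by
    intro n
    unfold qFourier jackson
    simp_rw [zpow_mul_mul_rpow, hj, mul_assoc]
  have key := tsum_translation_nonneg hp0 hp1 x y
    (fun z => mul_nonneg (zpow_pos hp0 z).le (hf0' z)) hg
  have hterm : ∀ n : ℤ, q ^ n * (qFourier q 0 f (q ^ n) * jHE q 0 (q ^ x * q ^ n) *
      jHE q 0 (q ^ y * q ^ n) * (q ^ n) ^ (2 * (0 : ℝ) + 1)) = cqv q 0 * (1 - q) *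
      ((q ^ 2) ^ n * (hahnSum (q ^ 2) (q ^ 2) (n + x) * hahnSum (q ^ 2) (q ^ 2) (n + y)) *
        ∑' z : ℤ, (q ^ 2) ^ z * f (q ^ z) * hahnSum (q ^ 2) (q ^ 2) (n + z)) := fun n => by
    rw [zpow_mul_mul_rpow, hF, hj, hj, add_comm x, add_comm y]
    ring
  have hT : qTrans q 0 (q ^ x) f (q ^ y) = (cqv q 0 * (1 - q)) ^ 2 *
      ∑' n : ℤ, (q ^ 2) ^ n * (hahnSum (q ^ 2) (q ^ 2) (n + x) * hahnSum (q ^ 2) (q ^ 2) (n + y)) *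
        ∑' z : ℤ, (q ^ 2) ^ z * f (q ^ z) * hahnSum (q ^ 2) (q ^ 2) (n + z) := by
    unfold qTrans jackson
    rw [tsum_congr hterm, tsum_mul_left]
    ring
  rw [hT]
  exact mul_nonneg (sq_nonneg _) key

/-- `Q_0 = (0,1)`. -/
theorem stmt10 : Qset 0 = Set.Ioo (0 : ℝ) 1 := by
  refine Set.ext fun q => ⟨fun h => h.1, fun h => ⟨h, ?_⟩⟩
  rintro _ ⟨x, rfl⟩
  exact isPosT_zero h.1 h.2 x
end
end

section
/- Let 0<q<1. For all m, r, k ∈ ℤ the kernel of order v = -1/2 satisfies D_{-1/2}(q^m,q^r,q^k) = (1/(1-q)) q^{-m} J_{2(r-m)}(q^{k-m},q), where J denotes the Hahn–Exton q-Bessel function with base q. -/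
open scoped BigOperators

noncomputable section

/-- The reciprocal q-Pochhammer symbol `1 / (p;p)_i`, extended by zero to negative integers. -/
def recipPoch (p : ℝ) (i : ℤ) : ℝ := qPochInf (p ^ (i + 1)) p / qPochInf p p

section Pochhammer

variable {p : ℝ}

lemma multipliable_one_sub_mul_pow (hp0 : 0 < p) (hp1 : p < 1) (a : ℝ) :
    Multipliable fun i : ℕ => (1 - a * p ^ i) := by
  have h : Summable fun i : ℕ => -(a * p ^ i) :=
    ((summable_geometric_of_lt_one hp0.le hp1).mul_left a).neg
  simpa [sub_eq_add_neg] using Real.multipliable_one_add_of_summable h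

lemma qPochInf_eq_mul (hp0 : 0 < p) (hp1 : p < 1) (a : ℝ) :
    qPochInf a p = (1 - a) * qPochInf (a * p) p := by
  have h := multipliable_one_sub_mul_pow hp0 hp1 (a * p)
  unfold qPochInf
  rw [tprod_eq_zero_mul' (f := fun i : ℕ => 1 - a * p ^ i)]
  · simp [pow_succ', mul_assoc]
  · simpa [pow_succ', mul_assoc] using h

lemma tendsto_qPoch (hp0 : 0 < p) (hp1 : p < 1) (a : ℝ) :
    Filter.Tendsto (qPoch a p) Filter.atTop (nhds (qPochInf a p)) :=
  (multipliable_one_sub_mul_pow hp0 hp1 a).tendsto_prod_tprod_nat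

lemma qPochInf_nonneg (hp0 : 0 < p) (hp1 : p < 1) {a : ℝ} (ha1 : a ≤ 1) :
    0 ≤ qPochInf a p := by
  refine ge_of_tendsto' (tendsto_qPoch hp0 hp1 a) fun n => Finset.prod_nonneg fun i _ => ?_
  have h1 : p ^ i ≤ 1 := pow_le_one₀ hp0.le hp1.le
  have h2 : 0 < p ^ i := by positivity
  nlinarith

lemma qPochInf_le_one (hp0 : 0 < p) (hp1 : p < 1) {a : ℝ} (ha0 : 0 ≤ a) (ha1 : a ≤ 1) :
    qPochInf a p ≤ 1 := by
  refine le_of_tendsto' (tendsto_qPoch hp0 hp1 a) fun n => Finset.prod_le_one ?_ ?_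
  · intro i _
    have h1 : p ^ i ≤ 1 := pow_le_one₀ hp0.le hp1.le
    have h2 : 0 < p ^ i := by positivity
    nlinarith
  · intro i _
    have h2 : 0 < p ^ i := by positivity
    nlinarith

lemma qPochInf_pos (hp0 : 0 < p) (hp1 : p < 1) {a : ℝ} (ha1 : a < 1) :
    0 < qPochInf a p := by
  refine lt_of_le_of_ne (qPochInf_nonneg hp0 hp1 ha1.le) (Ne.symm ?_)
  have h := tprod_one_add_ne_zero_of_summable (R := ℝ) (f := fun i : ℕ => -(a * p ^ i)) ?_ ?_
  · simpa [qPochInf, sub_eq_add_neg] using h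
  · intro i
    have h1 : p ^ i ≤ 1 := pow_le_one₀ hp0.le hp1.le
    have h2 : 0 < p ^ i := by positivity
    nlinarith
  · exact ((summable_geometric_of_lt_one hp0.le hp1).mul_left a).neg.norm

lemma recipPoch_sub_one (hp0 : 0 < p) (hp1 : p < 1) (i : ℤ) :
    recipPoch p (i - 1) = (1 - p ^ i) * recipPoch p i := by
  unfold recipPoch
  rw [sub_add_cancel, qPochInf_eq_mul hp0 hp1 (p ^ i), zpow_add_one₀ hp0.ne', mul_div_assoc]

lemma recipPoch_zero (hp0 : 0 < p) (hp1 : p < 1) : recipPoch p 0 = 1 := by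
  unfold recipPoch
  rw [zero_add, zpow_one, div_self (qPochInf_pos hp0 hp1 hp1).ne']

lemma recipPoch_of_neg (hp0 : 0 < p) (hp1 : p < 1) {i : ℤ} (hi : i < 0) :
    recipPoch p i = 0 := by
  obtain ⟨n, rfl⟩ : ∃ n : ℕ, i = -1 - n := ⟨(-1 - i).toNat, by omega⟩
  induction n with
  | zero =>
    have := recipPoch_sub_one hp0 hp1 0
    simpa using this
  | succ n ih =>
    have := recipPoch_sub_one hp0 hp1 (-1 - n)
    rw [ih (by omega), mul_zero] at this
    rw [← this]
    push_cast
    ring_nf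

lemma recipPoch_nonneg (hp0 : 0 < p) (hp1 : p < 1) (i : ℤ) : 0 ≤ recipPoch p i := by
  rcases lt_or_ge i 0 with hi | hi
  · rw [recipPoch_of_neg hp0 hp1 hi]
  · exact div_nonneg (qPochInf_nonneg hp0 hp1 (zpow_le_one₀ hp0 hp1.le (by omega)))
      (qPochInf_pos hp0 hp1 hp1).le

lemma recipPoch_pos (hp0 : 0 < p) (hp1 : p < 1) (n : ℕ) : 0 < recipPoch p n := by
  refine div_pos (qPochInf_pos hp0 hp1 ?_) (qPochInf_pos hp0 hp1 hp1)
  have : p ^ ((n : ℤ) + 1) = p ^ (n + 1) := by exact_mod_cast rfl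
  rw [this]
  exact pow_lt_one₀ hp0.le hp1 (by omega)

lemma abs_recipPoch_le (hp0 : 0 < p) (hp1 : p < 1) (i : ℤ) :
    |recipPoch p i| ≤ (qPochInf p p)⁻¹ := by
  have h := qPochInf_pos hp0 hp1 hp1
  rw [abs_of_nonneg (recipPoch_nonneg hp0 hp1 i)]
  rcases lt_or_ge i 0 with hi | hi
  · rw [recipPoch_of_neg hp0 hp1 hi]
    positivity
  · rw [← one_div]
    unfold recipPoch
    gcongr
    exact qPochInf_le_one hp0 hp1 (by positivity)
      (zpow_le_one₀ hp0 hp1.le (by omega))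

lemma one_div_qPoch (hp0 : 0 < p) (hp1 : p < 1) (n : ℕ) :
    (qPoch p p n)⁻¹ = recipPoch p n := by
  induction n with
  | zero => simp [qPoch, recipPoch_zero hp0 hp1]
  | succ n ih =>
    have h := recipPoch_sub_one hp0 hp1 ((n : ℤ) + 1)
    have h1 : p ^ ((n : ℤ) + 1) = p * p ^ n := by rw [zpow_add_one₀ hp0.ne', zpow_natCast, mul_comm]
    have h2 : p * p ^ n < 1 := by
      rw [← pow_succ']
      exact pow_lt_one₀ hp0.le hp1 (by omega)
    rw [add_sub_cancel_right, h1] at h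
    unfold qPoch at ih ⊢
    rw [Finset.prod_range_succ, mul_inv, ih, h]
    have : 1 - p * p ^ n ≠ 0 := by linarith
    push_cast
    field_simp

end Pochhammer

section Euler

variable {q : ℝ}

lemma sq_lt_one_of_lt_one (hq0 : 0 < q) (hq1 : q < 1) : q ^ 2 < 1 := pow_lt_one₀ hq0.le hq1 two_ne_zero

lemma sq_zpow (q : ℝ) (i : ℤ) : (q ^ 2) ^ i = q ^ (2 * i) := by
  rw [zpow_mul, zpow_ofNat]

lemma recipPoch_sq_sub_one (hq0 : 0 < q) (hq1 : q < 1) (i : ℤ) :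
    recipPoch (q ^ 2) (i - 1) = (1 - q ^ (2 * i)) * recipPoch (q ^ 2) i := by
  rw [recipPoch_sub_one (by positivity) (sq_lt_one_of_lt_one hq0 hq1), sq_zpow]

/-- The `j`-th term of Euler's expansion of `(q^{N+1};q²)_∞`. -/
def eulerTerm (q : ℝ) (N : ℤ) (j : ℕ) : ℝ :=
  (-1) ^ j * q ^ ((j : ℤ) ^ 2 + N * j) * recipPoch (q ^ 2) j

/-- A uniform bound for the reciprocal q-Pochhammer symbols of base `q²`. -/
def pochBound (q : ℝ) : ℝ := (qPochInf (q ^ 2) (q ^ 2))⁻¹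

lemma pochBound_pos (hq0 : 0 < q) (hq1 : q < 1) : 0 < pochBound q :=
  inv_pos.2 (qPochInf_pos (by positivity) (sq_lt_one_of_lt_one hq0 hq1)
    (sq_lt_one_of_lt_one hq0 hq1))

lemma abs_recipPoch_sq_le (hq0 : 0 < q) (hq1 : q < 1) (i : ℤ) :
    |recipPoch (q ^ 2) i| ≤ pochBound q :=
  abs_recipPoch_le (by positivity) (sq_lt_one_of_lt_one hq0 hq1) i

lemma abs_eulerTerm_le (hq0 : 0 < q) (hq1 : q < 1) {N M : ℤ} {j : ℕ}
    (h : M ≤ (j : ℤ) ^ 2 + N * j) :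
    |eulerTerm q N j| ≤ pochBound q * q ^ M := by
  unfold eulerTerm
  rw [abs_mul, abs_mul, abs_pow, abs_neg, abs_one, one_pow, one_mul, abs_of_pos (zpow_pos hq0 _),
    mul_comm]
  have := pochBound_pos hq0 hq1
  exact mul_le_mul (abs_recipPoch_sq_le hq0 hq1 _) (zpow_le_zpow_right_of_le_one₀ hq0 hq1.le h)
    (zpow_pos hq0 _).le this.le

lemma abs_eulerTerm_le_geom (hq0 : 0 < q) (hq1 : q < 1) {N N' : ℤ} (hN : N ≤ N') (j : ℕ) :
    |eulerTerm q N' j| ≤ pochBound q * q ^ (-(N - 1) ^ 2) * q ^ j := by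
  refine (abs_eulerTerm_le hq0 hq1 (M := -(N - 1) ^ 2 + j) ?_).trans_eq ?_
  · have : (0 : ℤ) ≤ (N' - N) * j := mul_nonneg (by omega) (by positivity)
    nlinarith [sq_nonneg ((j : ℤ) + (N - 1)), sq_nonneg ((j : ℤ)), sq_nonneg (N - 1)]
  · rw [zpow_add₀ hq0.ne', zpow_natCast, mul_assoc]

lemma summable_const_mul_pow (hq0 : 0 < q) (hq1 : q < 1) (K : ℝ) :
    Summable fun j : ℕ => K * q ^ j :=
  (summable_geometric_of_lt_one hq0.le hq1).mul_left K

lemma summable_eulerTerm (hq0 : 0 < q) (hq1 : q < 1) (N : ℤ) : Summable (eulerTerm q N) :=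
  Summable.of_norm_bounded (summable_const_mul_pow hq0 hq1 _)
    fun j => abs_eulerTerm_le_geom hq0 hq1 le_rfl j

lemma tsum_eulerTerm_rec (hq0 : 0 < q) (hq1 : q < 1) (N : ℤ) :
    ∑' j, eulerTerm q N j = (1 - q ^ (N + 1)) * ∑' j, eulerTerm q (N + 2) j := by
  have h0 := summable_eulerTerm hq0 hq1 N
  have h2 := summable_eulerTerm hq0 hq1 (N + 2)
  have hdiff : ∑' j, (eulerTerm q N j - eulerTerm q (N + 2) j)
      = ∑' j, -q ^ (N + 1) * eulerTerm q (N + 2) j := by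
    rw [(h0.sub h2).tsum_eq_zero_add]
    have hz : eulerTerm q N 0 - eulerTerm q (N + 2) 0 = 0 := by simp [eulerTerm]
    rw [hz, zero_add]
    refine tsum_congr fun j => ?_
    have hr := recipPoch_sq_sub_one hq0 hq1 ((j : ℤ) + 1)
    rw [add_sub_cancel_right] at hr
    unfold eulerTerm
    rw [hr]
    push_cast
    have e1 : q ^ (((j : ℤ) + 1) ^ 2 + (N + 2) * (j + 1))
        = q ^ (((j : ℤ) + 1) ^ 2 + N * (j + 1)) * q ^ (2 * ((j : ℤ) + 1)) := by
      rw [← zpow_add₀ hq0.ne']; ring_nf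
    have e2 : q ^ (((j : ℤ) + 1) ^ 2 + N * (j + 1))
        = q ^ (N + 1) * q ^ ((j : ℤ) ^ 2 + (N + 2) * j) := by
      rw [← zpow_add₀ hq0.ne']; ring_nf
    rw [e1, e2]
    ring
  rw [h0.tsum_sub h2, tsum_mul_left] at hdiff
  linarith

lemma tendsto_tsum_eulerTerm (hq0 : 0 < q) (hq1 : q < 1) (N : ℤ) :
    Filter.Tendsto (fun n : ℕ => ∑' j, eulerTerm q (N + 2 * n) j) Filter.atTop (nhds 1) := by
  have hlim : ∑' j : ℕ, (if j = 0 then (1 : ℝ) else 0) = 1 := tsum_ite_eq 0 _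
  rw [← hlim]
  refine tendsto_tsum_of_dominated_convergence
    (summable_const_mul_pow hq0 hq1 (pochBound q * q ^ (-(N - 1) ^ 2))) (fun j => ?_)
    (Filter.Eventually.of_forall fun n j => abs_eulerTerm_le_geom hq0 hq1 (by omega) j)
  rcases Nat.eq_zero_or_pos j with rfl | hj
  · simp [eulerTerm, recipPoch_zero (show 0 < q ^ 2 by positivity) (sq_lt_one_of_lt_one hq0 hq1)]
  · rw [if_neg hj.ne']
    have h1 : (fun n : ℕ => eulerTerm q (N + 2 * n) j)
        = fun n : ℕ => eulerTerm q N j * (q ^ (2 * j)) ^ n := by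
      funext n
      have : q ^ ((j : ℤ) ^ 2 + (N + 2 * n) * j)
          = q ^ ((j : ℤ) ^ 2 + N * j) * (q ^ (2 * j)) ^ n := by
        rw [← pow_mul, ← zpow_natCast q (2 * j * n), ← zpow_add₀ hq0.ne']
        push_cast
        ring_nf
      unfold eulerTerm
      rw [this]
      ring
    rw [h1, ← mul_zero (eulerTerm q N j)]
    exact (tendsto_pow_atTop_nhds_zero_of_lt_one (by positivity)
      (pow_lt_one₀ hq0.le hq1 (by omega))).const_mul _

/-- Euler's expansion of the infinite q-Pochhammer symbol. -/
lemma tsum_eulerTerm (hq0 : 0 < q) (hq1 : q < 1) (N : ℤ) :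
    ∑' j, eulerTerm q N j = qPochInf (q ^ (N + 1)) (q ^ 2) := by
  have h : ∀ n : ℕ, ∑' j, eulerTerm q N j
      = qPoch (q ^ (N + 1)) (q ^ 2) n * ∑' j, eulerTerm q (N + 2 * n) j := by
    intro n
    induction n with
    | zero => simp [qPoch]
    | succ n ih =>
      rw [ih, tsum_eulerTerm_rec hq0 hq1 (N + 2 * n)]
      unfold qPoch
      rw [Finset.prod_range_succ]
      have e : q ^ (N + 2 * n + 1) = q ^ (N + 1) * (q ^ 2) ^ n := by
        rw [← zpow_natCast (q ^ 2) n, sq_zpow, ← zpow_add₀ hq0.ne']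
        ring_nf
      rw [e]
      push_cast
      ring_nf
  have hl := (tendsto_qPoch (by positivity) (sq_lt_one_of_lt_one hq0 hq1) (q ^ (N + 1))).mul
    (tendsto_tsum_eulerTerm hq0 hq1 N)
  rw [mul_one] at hl
  exact tendsto_nhds_unique (tendsto_const_nhds.congr h) hl

lemma tsum_eulerTerm_odd (hq0 : 0 < q) (hq1 : q < 1) (i : ℤ) :
    ∑' j, eulerTerm q (2 * i + 1) j = qPochInf (q ^ 2) (q ^ 2) * recipPoch (q ^ 2) i := by
  have h := (qPochInf_pos (by positivity) (sq_lt_one_of_lt_one hq0 hq1)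
    (sq_lt_one_of_lt_one hq0 hq1)).ne'
  rw [tsum_eulerTerm hq0 hq1, recipPoch, mul_div_cancel₀ _ h, sq_zpow]
  ring_nf

end Euler

section Cosine

variable {q : ℝ}

/-- The `l`-th term of the q-cosine series at `q^n`. -/
def cosTerm (q : ℝ) (n : ℤ) (l : ℕ) : ℝ :=
  (-1) ^ l * q ^ ((l : ℤ) * (l + 1) + 2 * n * l) * recipPoch q (2 * l)

/-- The q-cosine `j_{-1/2}(q^n, q²)`. -/
def qCos (q : ℝ) (n : ℤ) : ℝ := ∑' l, cosTerm q n l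

/-- The q-cosine times `(q;q²)_∞ / (q²;q²)_∞`, as a Laurent coefficient of
`(q/s;q²)_∞ / (s;q²)_∞`. -/
def normCos (q : ℝ) (n : ℤ) : ℝ := ∑' j, eulerTerm q 0 j * recipPoch (q ^ 2) (n + j)

lemma recipPoch_double_succ (hq0 : 0 < q) (hq1 : q < 1) (l : ℕ) :
    recipPoch q (2 * l) =
      (1 - q * q ^ (2 * l)) * (1 - q ^ 2 * q ^ (2 * l)) * recipPoch q (2 * (l + 1 : ℕ)) := by
  have h1 := recipPoch_sub_one hq0 hq1 (2 * (l : ℤ) + 1)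
  have h2 := recipPoch_sub_one hq0 hq1 (2 * (l : ℤ) + 2)
  have e1 : q ^ (2 * (l : ℤ) + 1) = q * q ^ (2 * l) := by
    rw [← pow_succ', ← zpow_natCast q (2 * l + 1)]; push_cast; rfl
  have e2 : q ^ (2 * (l : ℤ) + 2) = q ^ 2 * q ^ (2 * l) := by
    rw [← pow_add, ← zpow_natCast q (2 + 2 * l)]; push_cast; ring_nf
  rw [e1] at h1
  rw [e2] at h2
  rw [show 2 * (l : ℤ) + 1 - 1 = 2 * l by ring] at h1
  rw [show 2 * (l : ℤ) + 2 - 1 = 2 * l + 1 by ring] at h2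
  rw [h1, h2, show (2 : ℤ) * (l + 1 : ℕ) = 2 * l + 2 by push_cast; ring]
  ring

lemma one_sub_mul_pow_pos (hq0 : 0 < q) (hq1 : q < 1) {a : ℝ} (ha0 : 0 < a) (ha1 : a < 1) (n : ℕ) :
    0 < 1 - a * q ^ n := by
  have h1 : q ^ n ≤ 1 := pow_le_one₀ hq0.le hq1.le
  have h2 : 0 < q ^ n := by positivity
  nlinarith

lemma inv_qPoch_mul_qPoch (hq0 : 0 < q) (hq1 : q < 1) (l : ℕ) :
    (qPoch (q ^ 2) (q ^ 2) l * qPoch q (q ^ 2) l)⁻¹ = recipPoch q (2 * l) := by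
  induction l with
  | zero => simp [qPoch, recipPoch_zero hq0 hq1]
  | succ l ih =>
    rw [recipPoch_double_succ hq0 hq1] at ih
    have h1 := (one_sub_mul_pow_pos hq0 hq1 hq0 hq1 (2 * l)).ne'
    have h2 := (one_sub_mul_pow_pos hq0 hq1 (by positivity) (sq_lt_one_of_lt_one hq0 hq1)
      (2 * l)).ne'
    unfold qPoch at ih ⊢
    rw [Finset.prod_range_succ, Finset.prod_range_succ, ← pow_mul]
    rw [mul_mul_mul_comm, mul_inv, ih]
    field_simp

lemma jHE_eq_qCos (hq0 : 0 < q) (hq1 : q < 1) (n : ℤ) :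
    jHE q (-(1 / 2)) (q ^ n) = qCos q n := by
  unfold jHE qCos
  refine tsum_congr fun l => ?_
  rw [show (2 : ℝ) * (-(1 / 2)) + 2 = 1 by norm_num, Real.rpow_one, div_eq_mul_inv,
    inv_qPoch_mul_qPoch hq0 hq1]
  unfold cosTerm
  rw [zpow_add₀ hq0.ne', ← mul_assoc ((-1 : ℝ) ^ l)]
  congr 2
  rw [← zpow_natCast (q ^ n), ← zpow_mul]; push_cast; ring_nf

lemma qPochInf_mul_recipPoch_double (hq0 : 0 < q) (hq1 : q < 1) (l : ℕ) :
    qPochInf q (q ^ 2) * recipPoch q (2 * l) =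
      recipPoch (q ^ 2) l * qPochInf (q ^ (2 * (l : ℤ) + 1)) (q ^ 2) := by
  have hp0 : 0 < q ^ 2 := by positivity
  have hp1 := sq_lt_one_of_lt_one hq0 hq1
  induction l with
  | zero => simp [recipPoch_zero hq0 hq1, recipPoch_zero hp0 hp1]
  | succ l ih =>
    rw [recipPoch_double_succ hq0 hq1, qPochInf_eq_mul hp0 hp1 (q ^ (2 * (l : ℤ) + 1))] at ih
    have h1 := (one_sub_mul_pow_pos hq0 hq1 hq0 hq1 (2 * l)).ne'
    have h2 := (one_sub_mul_pow_pos hq0 hq1 hp0 hp1 (2 * l)).ne'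
    have hr := recipPoch_sq_sub_one hq0 hq1 ((l : ℤ) + 1)
    have e1 : q ^ (2 * (l : ℤ) + 1) = q * q ^ (2 * l) := by
      rw [← pow_succ', ← zpow_natCast q (2 * l + 1)]; push_cast; rfl
    have e2 : q ^ (2 * ((l : ℤ) + 1)) = q ^ 2 * q ^ (2 * l) := by
      rw [← pow_add, ← zpow_natCast q (2 + 2 * l)]; push_cast; ring_nf
    have e3 : q ^ (2 * (((l + 1 : ℕ) : ℤ)) + 1) = q ^ (2 * (l : ℤ) + 1) * q ^ 2 := by
      rw [← zpow_natCast q 2, ← zpow_add₀ hq0.ne']; push_cast; ring_nf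
    rw [add_sub_cancel_right, e2] at hr
    rw [hr, ← e3, e1] at ih
    apply mul_left_cancel₀ (mul_ne_zero h1 h2)
    push_cast at ih ⊢
    linear_combination ih

lemma summable_mul_pow_prod (hq0 : 0 < q) (hq1 : q < 1) (K : ℝ) :
    Summable fun x : ℕ × ℕ => K * (q ^ x.1 * q ^ x.2) := by
  have h := summable_geometric_of_lt_one hq0.le hq1
  exact (h.mul_of_nonneg h (fun _ => by positivity) (fun _ => by positivity)).mul_left K

lemma normCos_eq (hq0 : 0 < q) (hq1 : q < 1) (n : ℤ) :
    qPochInf q (q ^ 2) / qPochInf (q ^ 2) (q ^ 2) * qCos q n = normCos q n := by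
  have hP := (qPochInf_pos (by positivity) (sq_lt_one_of_lt_one hq0 hq1)
    (sq_lt_one_of_lt_one hq0 hq1)).ne'
  set F : ℕ → ℕ → ℝ := fun l j =>
    (-1) ^ (l + j) * q ^ ((l : ℤ) * (l + 1) + 2 * n * l + (j : ℤ) ^ 2 + 2 * l * j) *
      (recipPoch (q ^ 2) l * recipPoch (q ^ 2) j) with hF
  have hsum : Summable (Function.uncurry F) := by
    refine Summable.of_norm_bounded
      (summable_mul_pow_prod hq0 hq1 (q ^ (-n ^ 2) * (pochBound q * pochBound q))) ?_
    rintro ⟨l, j⟩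
    simp only [Function.uncurry, hF]
    rw [Real.norm_eq_abs, abs_mul, abs_mul, abs_pow, abs_neg, abs_one, one_pow, one_mul,
      abs_of_pos (zpow_pos hq0 _), abs_mul]
    have hb := pochBound_pos hq0 hq1
    have h1 : q ^ ((l : ℤ) * (l + 1) + 2 * n * l + (j : ℤ) ^ 2 + 2 * l * j)
        ≤ q ^ (-n ^ 2) * (q ^ l * q ^ j) := by
      rw [← zpow_natCast q l, ← zpow_natCast q j, ← zpow_add₀ hq0.ne', ← zpow_add₀ hq0.ne']
      refine zpow_le_zpow_right_of_le_one₀ hq0 hq1.le ?_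
      have h2 : (j : ℤ) ≤ (j : ℤ) ^ 2 := by exact_mod_cast Nat.le_self_pow two_ne_zero j
      have h3 : (0 : ℤ) ≤ (l : ℤ) * j := by positivity
      nlinarith [sq_nonneg ((l : ℤ) + n)]
    have h2 := mul_le_mul (abs_recipPoch_sq_le hq0 hq1 l) (abs_recipPoch_sq_le hq0 hq1 j)
      (abs_nonneg _) hb.le
    refine (mul_le_mul h1 h2 (by positivity) (by positivity)).trans_eq (by ring)
  have hl : ∀ l : ℕ, ∑' j, F l j = qPochInf q (q ^ 2) * cosTerm q n l := by
    intro l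
    have h := qPochInf_mul_recipPoch_double hq0 hq1 l
    rw [← tsum_eulerTerm hq0 hq1 (2 * l)] at h
    have : qPochInf q (q ^ 2) * cosTerm q n l
        = (-1) ^ l * q ^ ((l : ℤ) * (l + 1) + 2 * n * l) * recipPoch (q ^ 2) l *
          ∑' j, eulerTerm q (2 * l) j := by
      unfold cosTerm
      linear_combination (-1) ^ l * q ^ ((l : ℤ) * (l + 1) + 2 * n * l) * h
    rw [this, ← tsum_mul_left]
    refine tsum_congr fun j => ?_
    simp only [hF, eulerTerm]
    rw [show (l : ℤ) * (l + 1) + 2 * n * l + (j : ℤ) ^ 2 + 2 * l * j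
      = ((l : ℤ) * (l + 1) + 2 * n * l) + ((j : ℤ) ^ 2 + 2 * l * j) by ring,
      zpow_add₀ hq0.ne', pow_add]
    ring
  have hj : ∀ j : ℕ, ∑' l, F l j =
      qPochInf (q ^ 2) (q ^ 2) * (eulerTerm q 0 j * recipPoch (q ^ 2) (n + j)) := by
    intro j
    have h := tsum_eulerTerm_odd hq0 hq1 (n + j)
    rw [mul_left_comm, ← h, ← tsum_mul_left]
    refine tsum_congr fun l => ?_
    simp only [hF, eulerTerm]
    rw [show (l : ℤ) * (l + 1) + 2 * n * l + (j : ℤ) ^ 2 + 2 * l * j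
      = ((j : ℤ) ^ 2 + 0 * j) + ((l : ℤ) ^ 2 + (2 * (n + j) + 1) * l) by ring,
      zpow_add₀ hq0.ne', pow_add]
    ring
  have hswap := hsum.tsum_comm
  simp only [hl, hj, tsum_mul_left] at hswap
  unfold qCos normCos
  rw [div_mul_eq_mul_div, div_eq_iff hP, ← hswap]
  ring

lemma summable_cosTerm (hq0 : 0 < q) (hq1 : q < 1) (n : ℤ) : Summable (cosTerm q n) := by
  refine Summable.of_norm_bounded
    (summable_const_mul_pow hq0 hq1 (q ^ (-n ^ 2) * (qPochInf q q)⁻¹)) fun l => ?_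
  unfold cosTerm
  rw [Real.norm_eq_abs, abs_mul, abs_mul, abs_pow, abs_neg, abs_one, one_pow, one_mul,
    abs_of_pos (zpow_pos hq0 _)]
  have h1 : q ^ ((l : ℤ) * (l + 1) + 2 * n * l) ≤ q ^ (-n ^ 2) * q ^ l := by
    rw [← zpow_natCast q l, ← zpow_add₀ hq0.ne']
    refine zpow_le_zpow_right_of_le_one₀ hq0 hq1.le ?_
    nlinarith [sq_nonneg ((l : ℤ) + n)]
  exact (mul_le_mul h1 (abs_recipPoch_le hq0 hq1 _) (abs_nonneg _) (by positivity)).trans_eq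
    (by ring)

lemma qCos_rec (hq0 : 0 < q) (hq1 : q < 1) (n : ℤ) :
    qCos q (n - 1) - (1 + q⁻¹) * qCos q n + q⁻¹ * qCos q (n + 1) = -q ^ (2 * n) * qCos q n := by
  have h0 := summable_cosTerm hq0 hq1 (n - 1)
  have h1 := (summable_cosTerm hq0 hq1 n).mul_left (1 + q⁻¹)
  have h2 := (summable_cosTerm hq0 hq1 (n + 1)).mul_left q⁻¹
  unfold qCos
  rw [← tsum_mul_left, ← tsum_mul_left, ← tsum_mul_left, ← h0.tsum_sub h1,
    ← (h0.sub h1).tsum_add h2, ((h0.sub h1).add h2).tsum_eq_zero_add]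
  have hz : cosTerm q (n - 1) 0 - (1 + q⁻¹) * cosTerm q n 0 + q⁻¹ * cosTerm q (n + 1) 0 = 0 := by
    simp [cosTerm]
    ring
  rw [hz, zero_add]
  refine tsum_congr fun l => ?_
  unfold cosTerm
  rw [recipPoch_double_succ hq0 hq1 l]
  have e0 : q ^ (((l + 1 : ℕ) : ℤ) * ((l + 1 : ℕ) + 1) + 2 * (n - 1) * (l + 1 : ℕ))
      = q ^ (2 * n) * q ^ ((l : ℤ) * (l + 1) + 2 * n * l) := by
    rw [← zpow_add₀ hq0.ne']; push_cast; ring_nf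
  have e1 : q ^ (((l + 1 : ℕ) : ℤ) * ((l + 1 : ℕ) + 1) + 2 * n * (l + 1 : ℕ))
      = q ^ (2 * n) * q ^ ((l : ℤ) * (l + 1) + 2 * n * l) * (q ^ 2 * q ^ (2 * l)) := by
    rw [← pow_add, ← zpow_natCast q (2 + 2 * l), ← zpow_add₀ hq0.ne', ← zpow_add₀ hq0.ne']
    push_cast; ring_nf
  have e2 : q ^ (((l + 1 : ℕ) : ℤ) * ((l + 1 : ℕ) + 1) + 2 * (n + 1) * (l + 1 : ℕ))
      = q ^ (2 * n) * q ^ ((l : ℤ) * (l + 1) + 2 * n * l) * (q ^ 2 * q ^ (2 * l)) ^ 2 := by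
    rw [← pow_add, ← pow_mul, ← zpow_natCast q ((2 + 2 * l) * 2), ← zpow_add₀ hq0.ne',
      ← zpow_add₀ hq0.ne']
    push_cast; ring_nf
  rw [e0, e1, e2, pow_succ]
  field_simp
  ring

lemma normCos_rec (hq0 : 0 < q) (hq1 : q < 1) (n : ℤ) :
    normCos q (n - 1) - (1 + q⁻¹) * normCos q n + q⁻¹ * normCos q (n + 1)
      = -q ^ (2 * n) * normCos q n := by
  simp only [← normCos_eq hq0 hq1]
  linear_combination qPochInf q (q ^ 2) / qPochInf (q ^ 2) (q ^ 2) * qCos_rec hq0 hq1 n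

end Cosine

section Orthogonality

variable {q : ℝ}

lemma summable_zpow_abs (hq0 : 0 < q) (hq1 : q < 1) : Summable fun n : ℤ => q ^ |n| := by
  have h := summable_geometric_of_lt_one hq0.le hq1
  refine Summable.of_nat_of_neg ?_ ?_ <;> simpa using h

lemma abs_normCos_le (hq0 : 0 < q) (hq1 : q < 1) {n M : ℤ}
    (h : ∀ j : ℕ, 0 ≤ n + j → M + j ≤ (j : ℤ) ^ 2) :
    |normCos q n| ≤ pochBound q * pochBound q * (1 - q)⁻¹ * q ^ M := by
  have hb := pochBound_pos hq0 hq1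
  have hs := summable_const_mul_pow hq0 hq1 (pochBound q * pochBound q * q ^ M)
  have hle := tsum_of_norm_bounded (f := fun j : ℕ => eulerTerm q 0 j * recipPoch (q ^ 2) (n + j))
    hs.hasSum fun j => ?_
  · refine hle.trans_eq ?_
    rw [tsum_mul_left, tsum_geometric_of_lt_one hq0.le hq1]
    ring
  · rw [Real.norm_eq_abs, abs_mul]
    rcases lt_or_ge (n + j) 0 with hj | hj
    · rw [recipPoch_of_neg (by positivity) (sq_lt_one_of_lt_one hq0 hq1) hj, abs_zero, mul_zero]
      positivity
    · have h1 := abs_eulerTerm_le hq0 hq1 (N := 0) (M := M + j) (j := j) (by simpa using h j hj)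
      rw [zpow_add₀ hq0.ne', zpow_natCast] at h1
      refine (mul_le_mul h1 (abs_recipPoch_sq_le hq0 hq1 _) (abs_nonneg _)
        (by positivity)).trans_eq (by ring)

lemma exists_normCos_bound (hq0 : 0 < q) (hq1 : q < 1) (m : ℤ) :
    ∃ K, 0 < K ∧ (∀ n, |normCos q (n + m)| ≤ K) ∧
      ∀ n ≤ 0, |normCos q (n + m)| ≤ K * q ^ ((n + m) ^ 2 + (n + m)) := by
  have hb := pochBound_pos hq0 hq1
  have hq : 0 < (1 - q)⁻¹ := inv_pos.2 (by linarith)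
  set K := pochBound q * pochBound q * (1 - q)⁻¹ with hK
  have hK0 : 0 < K := by positivity
  have hm : 0 ≤ m ^ 2 + m := by
    rcases lt_or_ge m 0 with h | h <;> nlinarith
  have hA : ∀ n, |normCos q n| ≤ K := by
    intro n
    have := abs_normCos_le hq0 hq1 (n := n) (M := 0) fun j _ => by
      rw [zero_add]; exact_mod_cast Nat.le_self_pow two_ne_zero j
    simpa using this
  have hB : ∀ n ≤ 0, |normCos q n| ≤ K * q ^ (n ^ 2 + n) := by
    intro n hn
    refine abs_normCos_le hq0 hq1 fun j hj => ?_
    rcases eq_or_lt_of_le hj with h0 | h0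
    · nlinarith
    · nlinarith
  have h1 : 1 ≤ q ^ (-(m ^ 2 + m)) := by
    simpa using zpow_le_zpow_right_of_le_one₀ hq0 hq1.le (show -(m ^ 2 + m) ≤ 0 by omega)
  refine ⟨K * q ^ (-(m ^ 2 + m)), by positivity, fun n => ?_, fun n hn => ?_⟩
  · exact (hA _).trans (le_mul_of_one_le_right hK0.le h1)
  · rcases le_or_gt (n + m) 0 with h | h
    · refine (hB _ h).trans (mul_le_mul_of_nonneg_right ?_ (by positivity))
      exact le_mul_of_one_le_right hK0.le h1
    · refine (hA _).trans ?_
      rw [mul_assoc, ← zpow_add₀ hq0.ne']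
      refine le_mul_of_one_le_right hK0.le ?_
      have h2 : -(m ^ 2 + m) + ((n + m) ^ 2 + (n + m)) ≤ 0 := by nlinarith
      simpa using zpow_le_zpow_right_of_le_one₀ hq0 hq1.le h2

lemma summable_zpow_mul_normCos (hq0 : 0 < q) (hq1 : q < 1) (d : ℤ) :
    Summable fun n : ℤ => q ^ n * normCos q (n + d) := by
  obtain ⟨K, hK, hA, hB⟩ := exists_normCos_bound hq0 hq1 d
  refine Summable.of_norm_bounded
    ((summable_zpow_abs hq0 hq1).mul_left (K * q ^ (-(2 * d + 3) ^ 2 - d ^ 2))) fun n => ?_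
  rw [Real.norm_eq_abs, abs_mul, abs_of_pos (zpow_pos hq0 _), mul_assoc, ← zpow_add₀ hq0.ne']
  rcases le_or_gt n 0 with hn | hn
  · refine (mul_le_mul_of_nonneg_left (hB n hn) (by positivity)).trans ?_
    rw [mul_left_comm, ← zpow_add₀ hq0.ne']
    refine mul_le_mul_of_nonneg_left (zpow_le_zpow_right_of_le_one₀ hq0 hq1.le ?_) hK.le
    rw [abs_of_nonpos hn]
    have hd : 0 ≤ d ^ 2 + d := by rcases lt_or_ge d 0 with h | h <;> nlinarith
    nlinarith [sq_nonneg (n + (2 * d + 3)), sq_nonneg n, sq_nonneg (2 * d + 3), sq_nonneg d]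
  · rw [mul_comm]
    refine mul_le_mul (hA n) (zpow_le_zpow_right_of_le_one₀ hq0 hq1.le ?_) (by positivity) hK.le
    rw [abs_of_pos hn]
    nlinarith [sq_nonneg (2 * d + 3), sq_nonneg d]

lemma summable_eulerTerm_mul_recipPoch (hq0 : 0 < q) (hq1 : q < 1) (N : ℤ) (f : ℕ → ℤ) :
    Summable fun j => eulerTerm q N j * recipPoch (q ^ 2) (f j) := by
  refine Summable.of_norm_bounded ((summable_eulerTerm hq0 hq1 N).norm.mul_right (pochBound q))
    fun j => ?_
  rw [norm_mul]
  exact mul_le_mul_of_nonneg_left (abs_recipPoch_sq_le hq0 hq1 _) (norm_nonneg _)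

lemma tsum_eulerTerm_mul_recipPoch_rec (hq0 : 0 < q) (hq1 : q < 1) (N : ℤ) :
    (1 - q ^ (2 * N)) * ∑' j : ℕ, eulerTerm q (-1) j * recipPoch (q ^ 2) (N - j) =
      (1 - q ^ (2 * (N - 1))) *
        ∑' j : ℕ, eulerTerm q (-1) j * recipPoch (q ^ 2) (N - 1 - j) := by
  have h0 := (summable_eulerTerm_mul_recipPoch hq0 hq1 (-1) fun j => N - j).mul_left
    (1 - q ^ (2 * N))
  have h1 := summable_eulerTerm_mul_recipPoch hq0 hq1 (-1) fun j => N - 1 - j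
  have hdiff : ∑' j : ℕ, ((1 - q ^ (2 * N)) * (eulerTerm q (-1) j * recipPoch (q ^ 2) (N - j)) -
      eulerTerm q (-1) j * recipPoch (q ^ 2) (N - 1 - j)) =
      ∑' j : ℕ, -q ^ (2 * (N - 1)) * (eulerTerm q (-1) j * recipPoch (q ^ 2) (N - 1 - j)) := by
    rw [(h0.sub h1).tsum_eq_zero_add]
    have hz : (1 - q ^ (2 * N)) * (eulerTerm q (-1) 0 * recipPoch (q ^ 2) (N - (0 : ℕ))) -
        eulerTerm q (-1) 0 * recipPoch (q ^ 2) (N - 1 - (0 : ℕ)) = 0 := by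
      have := recipPoch_sq_sub_one hq0 hq1 N
      simp only [Nat.cast_zero, sub_zero]
      rw [this]
      ring
    rw [hz, zero_add]
    refine tsum_congr fun j => ?_
    have hr := recipPoch_sq_sub_one hq0 hq1 ((j : ℤ) + 1)
    have hs := recipPoch_sq_sub_one hq0 hq1 (N - 1 - j)
    rw [add_sub_cancel_right] at hr
    unfold eulerTerm
    rw [hr]
    push_cast
    rw [show N - 1 - ((j : ℤ) + 1) = N - 1 - j - 1 by ring, hs,
      show N - ((j : ℤ) + 1) = N - 1 - j by ring]
    have e1 : q ^ (((j : ℤ) + 1) ^ 2 + -1 * (j + 1))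
        = q ^ ((j : ℤ) ^ 2 + -1 * j) * q ^ (2 * (j : ℤ)) := by
      rw [← zpow_add₀ hq0.ne']; ring_nf
    have e2 : q ^ (2 * ((j : ℤ) + 1)) = q ^ 2 * q ^ (2 * (j : ℤ)) := by
      rw [← zpow_natCast q 2, ← zpow_add₀ hq0.ne']; push_cast; ring_nf
    have e3 : q ^ (2 * N) = q ^ 2 * q ^ (2 * (j : ℤ)) * q ^ (2 * (N - 1 - j)) := by
      rw [← zpow_natCast q 2, ← zpow_add₀ hq0.ne', ← zpow_add₀ hq0.ne']; push_cast; ring_nf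
    have e4 : q ^ (2 * (N - 1)) = q ^ (2 * (j : ℤ)) * q ^ (2 * (N - 1 - j)) := by
      rw [← zpow_add₀ hq0.ne']; ring_nf
    rw [e1, e2, e3, e4]
    ring
  rw [h0.tsum_sub h1, tsum_mul_left, tsum_mul_left] at hdiff
  linarith

/-- The Cauchy product of the expansions of `(x;q²)_∞` and `1 / (x;q²)_∞`. -/
lemma tsum_eulerTerm_mul_recipPoch (hq0 : 0 < q) (hq1 : q < 1) (N : ℤ) :
    ∑' j : ℕ, eulerTerm q (-1) j * recipPoch (q ^ 2) (N - j) = if N = 0 then 1 else 0 := by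
  have hp0 : 0 < q ^ 2 := by positivity
  have hp1 := sq_lt_one_of_lt_one hq0 hq1
  rcases lt_trichotomy N 0 with hN | rfl | hN
  · rw [if_neg hN.ne]
    convert tsum_zero with j
    rw [recipPoch_of_neg hp0 hp1 (by omega), mul_zero]
  · rw [if_pos rfl, tsum_eq_single 0]
    · simp [eulerTerm, recipPoch_zero hp0 hp1]
    · intro j hj
      rw [recipPoch_of_neg hp0 hp1 (by omega), mul_zero]
  · rw [if_neg hN.ne']
    obtain ⟨n, rfl⟩ : ∃ n : ℕ, N = n + 1 := ⟨(N - 1).toNat, by omega⟩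
    have hne : ∀ n : ℕ, 1 - q ^ (2 * ((n : ℤ) + 1)) ≠ 0 := fun n => by
      have := zpow_lt_one₀ hq0 hq1 (show 0 < 2 * ((n : ℤ) + 1) by omega)
      linarith
    clear hN
    induction n with
    | zero =>
      have h := tsum_eulerTerm_mul_recipPoch_rec hq0 hq1 (((0 : ℕ) : ℤ) + 1)
      rw [show 2 * (((0 : ℕ) : ℤ) + 1 - 1) = 0 by norm_num, zpow_zero, sub_self, zero_mul] at h
      exact (mul_eq_zero.1 h).resolve_left (hne 0)
    | succ n ih =>
      have h := tsum_eulerTerm_mul_recipPoch_rec hq0 hq1 (((n + 1 : ℕ) : ℤ) + 1)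
      rw [show (((n + 1 : ℕ) : ℤ) + 1 - 1) = (n : ℤ) + 1 by push_cast; ring, ih, mul_zero] at h
      exact (mul_eq_zero.1 h).resolve_left (hne (n + 1))

lemma tsum_pow_mul_recipPoch_mul_normCos (hq0 : 0 < q) (hq1 : q < 1) (i : ℤ) :
    ∑' k : ℕ, q ^ k * recipPoch (q ^ 2) k * normCos q (i + k) = recipPoch (q ^ 2) i := by
  have hp0 : 0 < q ^ 2 := by positivity
  have hp1 := sq_lt_one_of_lt_one hq0 hq1
  have hb := pochBound_pos hq0 hq1
  set F : ℕ → ℕ → ℝ := fun k j =>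
    q ^ k * recipPoch (q ^ 2) k * (eulerTerm q 0 j * recipPoch (q ^ 2) (i + k + j)) with hF
  set f : ℕ → ℕ → ℝ := fun N j =>
    q ^ N * recipPoch (q ^ 2) (i + N) * (eulerTerm q (-1) j * recipPoch (q ^ 2) (N - j)) with hf
  have hFsum : Summable (Function.uncurry F) := by
    refine Summable.of_norm_bounded (summable_mul_pow_prod hq0 hq1 (pochBound q ^ 3)) ?_
    rintro ⟨k, j⟩
    simp only [Function.uncurry, hF]
    rw [Real.norm_eq_abs, abs_mul, abs_mul, abs_mul, abs_of_pos (pow_pos hq0 _)]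
    have h1 := abs_eulerTerm_le hq0 hq1 (N := 0) (M := j) (j := j)
      (by simpa using (by exact_mod_cast Nat.le_self_pow two_ne_zero j : (j : ℤ) ≤ (j : ℤ) ^ 2))
    rw [zpow_natCast] at h1
    have h2 := abs_recipPoch_sq_le hq0 hq1 k
    have h3 := abs_recipPoch_sq_le hq0 hq1 (i + k + j)
    calc _ ≤ q ^ k * pochBound q * (pochBound q * q ^ j * pochBound q) := by gcongr
      _ = _ := by ring
  have hfsum : Summable (Function.uncurry f) := by
    refine Summable.of_norm_bounded (summable_mul_pow_prod hq0 hq1 (pochBound q ^ 3 * q⁻¹)) ?_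
    rintro ⟨N, j⟩
    simp only [Function.uncurry, hf]
    rw [Real.norm_eq_abs, abs_mul, abs_mul, abs_mul, abs_of_pos (pow_pos hq0 _)]
    have h1 := abs_eulerTerm_le hq0 hq1 (N := -1) (M := -1 + j) (j := j)
      (by nlinarith [sq_nonneg ((j : ℤ) - 1)])
    rw [zpow_add₀ hq0.ne', zpow_natCast, zpow_neg_one] at h1
    have h2 := abs_recipPoch_sq_le hq0 hq1 (i + N)
    have h3 := abs_recipPoch_sq_le hq0 hq1 (N - j)
    calc _ ≤ q ^ N * pochBound q * (pochBound q * (q⁻¹ * q ^ j) * pochBound q) := by gcongr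
      _ = _ := by ring
  have hshift : ∀ j : ℕ, ∑' k, F k j = ∑' N, f N j := by
    intro j
    have hinj : Function.Injective fun k : ℕ => k + j := add_left_injective j
    rw [← hinj.tsum_eq (f := fun N => f N j)]
    · refine tsum_congr fun k => ?_
      simp only [hF, hf, eulerTerm]
      push_cast
      rw [show (j : ℤ) ^ 2 + 0 * j = ((j : ℤ) ^ 2 + -1 * j) + j by ring, zpow_add₀ hq0.ne',
        zpow_natCast, pow_add, add_sub_cancel_right, add_assoc]
      ring
    · intro N hN
      rcases lt_or_ge N j with h | h
      · refine absurd ?_ hN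
        simp only [hf]
        rw [recipPoch_of_neg hp0 hp1 (i := (N : ℤ) - j) (by omega)]
        simp
      · exact ⟨N - j, by simp [h]⟩
  have hl : ∀ k : ℕ, q ^ k * recipPoch (q ^ 2) k * normCos q (i + k) = ∑' j, F k j := by
    intro k
    simp only [hF]
    rw [tsum_mul_left, normCos]
  have hr : ∀ N : ℕ, ∑' j, f N j = if N = 0 then recipPoch (q ^ 2) i else 0 := by
    intro N
    simp only [hf]
    rw [tsum_mul_left, tsum_eulerTerm_mul_recipPoch hq0 hq1]
    rcases Nat.eq_zero_or_pos N with rfl | hN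
    · simp
    · rw [if_neg (by omega), if_neg (by omega), mul_zero]
  simp only [hl]
  rw [← hFsum.tsum_comm]
  simp only [hshift]
  rw [hfsum.tsum_comm]
  simp only [hr]
  exact tsum_ite_eq 0 _

lemma tsum_zpow_mul_normCos_mul_normCos (hq0 : 0 < q) (hq1 : q < 1) (d : ℤ) :
    ∑' n : ℤ, q ^ n * normCos q (n + d) * normCos q n = if d = 0 then 1 else 0 := by
  have hp0 : 0 < q ^ 2 := by positivity
  have hp1 := sq_lt_one_of_lt_one hq0 hq1
  set F : ℤ → ℕ → ℝ := fun n j =>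
    q ^ n * normCos q (n + d) * (eulerTerm q 0 j * recipPoch (q ^ 2) (n + j)) with hF
  have hFsum : Summable (Function.uncurry F) := by
    have h := ((summable_zpow_mul_normCos hq0 hq1 d).norm.mul_of_nonneg
      (summable_eulerTerm hq0 hq1 0).norm (fun _ => norm_nonneg _) fun _ => norm_nonneg _)
    refine Summable.of_norm_bounded (h.mul_right (pochBound q)) ?_
    rintro ⟨n, j⟩
    simp only [Function.uncurry, hF]
    rw [norm_mul, norm_mul (eulerTerm q 0 j), ← mul_assoc]
    exact mul_le_mul_of_nonneg_left (abs_recipPoch_sq_le hq0 hq1 _) (by positivity)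
  have hl : ∀ n : ℤ, q ^ n * normCos q (n + d) * normCos q n = ∑' j, F n j := by
    intro n
    simp only [hF]
    rw [tsum_mul_left]
    rfl
  have hr : ∀ j : ℕ, ∑' n, F n j = eulerTerm q (-1) j * recipPoch (q ^ 2) (d - j) := by
    intro j
    have hinj : Function.Injective fun k : ℕ => (k : ℤ) - j := fun a b h => by
      simp only at h
      omega
    rw [← hinj.tsum_eq, ← tsum_pow_mul_recipPoch_mul_normCos hq0 hq1 (d - j), ← tsum_mul_left]
    · refine tsum_congr fun k => ?_
      simp only [hF, eulerTerm]
      rw [sub_add_cancel, show (j : ℤ) ^ 2 + 0 * j = ((j : ℤ) ^ 2 + -1 * j) + j by ring,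
        zpow_add₀ hq0.ne', zpow_sub₀ hq0.ne', zpow_natCast, zpow_natCast,
        show (k : ℤ) - j + d = d - j + k by ring]
      field_simp
    · intro n hn
      rcases lt_or_ge (n + j) 0 with h | h
      · refine absurd ?_ hn
        simp only [hF]
        rw [recipPoch_of_neg hp0 hp1 h]
        simp
      · exact ⟨(n + j).toNat, by simp [h]⟩
  simp only [hl]
  rw [← hFsum.tsum_comm]
  simp only [hr]
  exact tsum_eulerTerm_mul_recipPoch hq0 hq1 d

end Orthogonality

section Moments

variable {q : ℝ}

lemma summable_normCos_mul_normCos_mul_cosTerm (hq0 : 0 < q) (hq1 : q < 1) (m r k : ℤ) :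
    Summable fun x : ℤ × ℕ =>
      q ^ x.1 * (normCos q (x.1 + m) * normCos q (x.1 + r)) * cosTerm q (x.1 + k) x.2 := by
  obtain ⟨K, hK, hA, hB⟩ := exists_normCos_bound hq0 hq1 m
  obtain ⟨L, hL, hC, hD⟩ := exists_normCos_bound hq0 hq1 r
  have hQ := qPochInf_pos hq0 hq1 hq1
  set M : ℤ := (m + r + 2 - k) ^ 2 + k ^ 2 with hM
  have hs := ((summable_zpow_abs hq0 hq1).mul_of_nonneg
    (summable_geometric_of_lt_one hq0.le hq1) (fun _ => by positivity) fun _ => by positivity)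
  refine Summable.of_norm_bounded
    (hs.mul_left (K * L * (qPochInf q q)⁻¹ * q ^ (-M))) ?_
  rintro ⟨n, l⟩
  simp only
  unfold cosTerm
  rw [Real.norm_eq_abs, abs_mul, abs_mul, abs_mul, abs_mul, abs_mul, abs_pow, abs_neg, abs_one,
    one_pow, one_mul, abs_of_pos (zpow_pos hq0 n), abs_of_pos (zpow_pos hq0 _)]
  have hE := abs_recipPoch_le hq0 hq1 (2 * l)
  rcases le_or_gt n 0 with hn | hn
  · have h1 := hB n hn
    have h2 := hD n hn
    calc _ ≤ q ^ n * (K * q ^ ((n + m) ^ 2 + (n + m)) * (L * q ^ ((n + r) ^ 2 + (n + r)))) *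
          (q ^ ((l : ℤ) * (l + 1) + 2 * (n + k) * l) * (qPochInf q q)⁻¹) := by gcongr
      _ = K * L * (qPochInf q q)⁻¹ * (q ^ n * q ^ ((n + m) ^ 2 + (n + m)) *
          q ^ ((n + r) ^ 2 + (n + r)) * q ^ ((l : ℤ) * (l + 1) + 2 * (n + k) * l)) := by ring
      _ ≤ K * L * (qPochInf q q)⁻¹ * (q ^ (-M) * (q ^ |n| * q ^ (l : ℤ))) := by
        simp only [← zpow_add₀ hq0.ne']
        refine mul_le_mul_of_nonneg_left (zpow_le_zpow_right_of_le_one₀ hq0 hq1.le ?_)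
          (by positivity)
        rw [abs_of_nonpos hn]
        have hm : 0 ≤ m ^ 2 + m := by rcases lt_or_ge m 0 with h | h <;> nlinarith
        have hr : 0 ≤ r ^ 2 + r := by rcases lt_or_ge r 0 with h | h <;> nlinarith
        nlinarith [sq_nonneg ((l : ℤ) + n + k), sq_nonneg (n + (m + r + 2 - k))]
      _ = _ := by rw [zpow_natCast]; ring
  · have h1 := hA n
    have h2 := hC n
    calc _ ≤ q ^ n * (K * L) *
          (q ^ ((l : ℤ) * (l + 1) + 2 * (n + k) * l) * (qPochInf q q)⁻¹) := by gcongr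
      _ = K * L * (qPochInf q q)⁻¹ * (q ^ n * q ^ ((l : ℤ) * (l + 1) + 2 * (n + k) * l)) := by
        ring
      _ ≤ K * L * (qPochInf q q)⁻¹ * (q ^ (-M) * (q ^ |n| * q ^ (l : ℤ))) := by
        simp only [← zpow_add₀ hq0.ne']
        refine mul_le_mul_of_nonneg_left (zpow_le_zpow_right_of_le_one₀ hq0 hq1.le ?_)
          (by positivity)
        rw [abs_of_pos hn]
        have h3 : 0 ≤ n * (l : ℤ) := by positivity
        nlinarith [sq_nonneg ((l : ℤ) + k), sq_nonneg (m + r + 2 - k)]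
      _ = _ := by rw [zpow_natCast]; ring

lemma cosTerm_add (hq0 : 0 < q) (n k : ℤ) (l : ℕ) :
    cosTerm q (n + k) l = q ^ (2 * (l : ℤ) * n) * cosTerm q k l := by
  unfold cosTerm
  rw [show (l : ℤ) * (l + 1) + 2 * (n + k) * l
    = 2 * (l : ℤ) * n + ((l : ℤ) * (l + 1) + 2 * k * l) by ring, zpow_add₀ hq0.ne']
  ring

/-- The `l`-th moment of a product of two translated q-cosines. -/
def cosMoment (q : ℝ) (l : ℕ) (d : ℤ) : ℝ :=
  ∑' n : ℤ, q ^ ((2 * (l : ℤ) + 1) * n) * (normCos q (n + d) * normCos q n)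

lemma summable_cosMoment (hq0 : 0 < q) (hq1 : q < 1) (l : ℕ) (d : ℤ) :
    Summable fun n : ℤ => q ^ ((2 * (l : ℤ) + 1) * n) * (normCos q (n + d) * normCos q n) := by
  have hinj : Function.Injective fun n : ℤ => (n, l) := fun a b h => (Prod.mk.inj h).1
  have h := (summable_normCos_mul_normCos_mul_cosTerm hq0 hq1 d 0 0).comp_injective hinj
  have hne : cosTerm q 0 l ≠ 0 := by
    unfold cosTerm
    have h1 := recipPoch_pos hq0 hq1 (2 * l)
    push_cast at h1
    exact mul_ne_zero (mul_ne_zero (pow_ne_zero _ (by norm_num)) (zpow_pos hq0 _).ne') h1.ne'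
  refine (summable_mul_right_iff hne).1 (h.congr fun n => ?_)
  have hc := cosTerm_add hq0 n 0 l
  rw [add_zero] at hc
  simp only [Function.comp_apply, add_zero, hc]
  rw [show (2 * (l : ℤ) + 1) * n = n + 2 * (l : ℤ) * n by ring, zpow_add₀ hq0.ne']
  ring

lemma cosMoment_succ (hq0 : 0 < q) (hq1 : q < 1) (l : ℕ) (d : ℤ) :
    cosMoment q (l + 1) d = -q ^ (-(2 * d)) * (cosMoment q l (d - 1) -
      (1 + q⁻¹) * cosMoment q l d + q⁻¹ * cosMoment q l (d + 1)) := by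
  have h0 := summable_cosMoment hq0 hq1 l (d - 1)
  have h1 := (summable_cosMoment hq0 hq1 l d).mul_left (1 + q⁻¹)
  have h2 := (summable_cosMoment hq0 hq1 l (d + 1)).mul_left q⁻¹
  unfold cosMoment
  rw [← tsum_mul_left, ← tsum_mul_left, ← h0.tsum_sub h1, ← (h0.sub h1).tsum_add h2,
    ← tsum_mul_left]
  refine tsum_congr fun n => ?_
  have h := normCos_rec hq0 hq1 (n + d)
  rw [show n + d - 1 = n + (d - 1) by ring, show n + d + 1 = n + (d + 1) by ring] at h
  have e1 : q ^ ((2 * ((l + 1 : ℕ) : ℤ) + 1) * n)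
      = q ^ (-(2 * d)) * q ^ (2 * (n + d)) * q ^ ((2 * (l : ℤ) + 1) * n) := by
    rw [← zpow_add₀ hq0.ne', ← zpow_add₀ hq0.ne']; push_cast; ring_nf
  rw [e1]
  linear_combination
    q ^ (-(2 * d)) * q ^ ((2 * (l : ℤ) + 1) * n) * normCos q n * h

/-- Triangular numbers, for all integers. -/
def tri (i : ℤ) : ℤ := i * (i + 1) / 2

lemma two_mul_tri (i : ℤ) : 2 * tri i = i * (i + 1) :=
  Int.mul_ediv_cancel' (Int.even_mul_succ_self i).two_dvd

lemma tri_succ (i : ℤ) : tri (i + 1) = tri i + (i + 1) := by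
  have h1 := two_mul_tri i
  have h2 := two_mul_tri (i + 1)
  linarith

lemma cosMoment_eq (hq0 : 0 < q) (hq1 : q < 1) (l : ℕ) (d : ℤ) :
    recipPoch q (2 * l) * cosMoment q l d = (-1) ^ d * q ^ (-((l : ℤ) * (l + 1))) *
      q ^ tri (l - d) * (recipPoch q (l - d) * recipPoch q (l + d)) := by
  induction l generalizing d with
  | zero =>
    have h := tsum_zpow_mul_normCos_mul_normCos hq0 hq1 d
    simp only [mul_assoc] at h
    simp only [cosMoment, Nat.cast_zero, mul_zero, zero_add, one_mul, recipPoch_zero hq0 hq1,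
      zero_sub, neg_zero, zpow_zero, mul_one, h]
    rcases lt_trichotomy d 0 with hd | rfl | hd
    · rw [if_neg hd.ne, recipPoch_of_neg hq0 hq1 hd, mul_zero, mul_zero]
    · simp [recipPoch_zero hq0 hq1, tri]
    · rw [if_neg hd.ne', recipPoch_of_neg hq0 hq1 (neg_lt_zero.2 hd), zero_mul, mul_zero]
  | succ l ih =>
    have h1 := (one_sub_mul_pow_pos hq0 hq1 hq0 hq1 (2 * l)).ne'
    have h2 := (one_sub_mul_pow_pos hq0 hq1 (by positivity) (sq_lt_one_of_lt_one hq0 hq1)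
      (2 * l)).ne'
    apply mul_left_cancel₀ (mul_ne_zero h1 h2)
    rw [← mul_assoc, ← recipPoch_double_succ hq0 hq1, cosMoment_succ hq0 hq1]
    have ha := ih (d - 1)
    have hb := ih d
    have hc := ih (d + 1)
    have k1 := recipPoch_sub_one hq0 hq1 ((l : ℤ) - d + 1)
    have k2 := recipPoch_sub_one hq0 hq1 ((l : ℤ) - d)
    have k3 := recipPoch_sub_one hq0 hq1 ((l : ℤ) + d + 1)
    have k4 := recipPoch_sub_one hq0 hq1 ((l : ℤ) + d)
    rw [add_sub_cancel_right] at k1 k3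
    rw [k1] at k2
    rw [k3] at k4
    rw [show (l : ℤ) - (d - 1) = l - d + 1 by ring, show (l : ℤ) + (d - 1) = l + d - 1 by ring,
      tri_succ, k4] at ha
    rw [k1, k3] at hb
    have t2 := tri_succ ((l : ℤ) - d - 1)
    rw [sub_add_cancel] at t2
    rw [show (l : ℤ) - (d + 1) = l - d - 1 by ring, show (l : ℤ) + (d + 1) = l + d + 1 by ring,
      show tri ((l : ℤ) - d - 1) = tri (l - d) - (l - d) by linarith, k2] at hc
    rw [show ((l + 1 : ℕ) : ℤ) - d = l - d + 1 by push_cast; ring,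
      show ((l + 1 : ℕ) : ℤ) + d = l + d + 1 by push_cast; ring, tri_succ]
    set X := recipPoch q ((l : ℤ) - d + 1)
    set Y := recipPoch q ((l : ℤ) + d + 1)
    have hq : q ≠ 0 := hq0.ne'
    have hm : (-1 : ℝ) ≠ 0 := by norm_num
    have hQ : q ^ l ≠ 0 := pow_ne_zero _ hq
    have hD : q ^ d ≠ 0 := zpow_ne_zero _ hq
    have eS : q ^ (-(((l + 1 : ℕ) : ℤ) * ((l + 1 : ℕ) + 1)))
        = q ^ (-((l : ℤ) * (l + 1))) * (q ^ l * q ^ l * q ^ 2)⁻¹ := by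
      rw [← pow_add, ← pow_add, ← zpow_natCast q (l + l + 2), ← zpow_neg, ← zpow_add₀ hq]
      push_cast; ring_nf
    have eD : q ^ (-(2 * d)) = (q ^ d * q ^ d)⁻¹ := by
      rw [← zpow_add₀ hq, ← zpow_neg]; ring_nf
    have eQ : q ^ (2 * l) = q ^ l * q ^ l := by rw [← pow_add]; ring_nf
    rw [eS, eD, eQ]
    simp only [zpow_add₀ hq, zpow_sub₀ hq, zpow_add₀ hm, zpow_sub₀ hm, zpow_one,
      zpow_natCast] at ha hb hc ⊢
    have hlin : recipPoch q (2 * l) * (-(q ^ d * q ^ d)⁻¹ * (cosMoment q l (d - 1) -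
        (1 + q⁻¹) * cosMoment q l d + q⁻¹ * cosMoment q l (d + 1))) =
        -(q ^ d * q ^ d)⁻¹ * (recipPoch q (2 * l) * cosMoment q l (d - 1) -
        (1 + q⁻¹) * (recipPoch q (2 * l) * cosMoment q l d) +
        q⁻¹ * (recipPoch q (2 * l) * cosMoment q l (d + 1))) := by ring
    rw [hlin, ha, hb, hc]
    generalize q ^ (-((l : ℤ) * (l + 1))) = S
    generalize q ^ tri ((l : ℤ) - d) = T
    generalize (-1 : ℝ) ^ d = s
    generalize q ^ l = Q at *
    generalize q ^ d = D at *
    field_simp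
    ring

/-- The Hahn–Exton q-Bessel function of even integer order on the lattice. -/
lemma JHE_even_order (hq0 : 0 < q) (hq1 : q < 1) (d b : ℤ) :
    JHE q (2 * (d : ℝ)) (q ^ (b : ℝ)) = ∑' l : ℕ, cosTerm q b l * cosMoment q l d := by
  set f : ℤ → ℝ := fun i => (-1) ^ i * q ^ (tri i + 2 * b * (i + d)) *
    (recipPoch q i * recipPoch q (i + 2 * d)) with hf
  have hP := (qPochInf_pos hq0 hq1 hq1).ne'
  have hm : (-1 : ℝ) ≠ 0 := by norm_num
  have hlhs : JHE q (2 * (d : ℝ)) (q ^ (b : ℝ)) = ∑' i : ℕ, f i := by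
    unfold JHE
    rw [← tsum_mul_left]
    refine tsum_congr fun i => ?_
    have e1 : (i : ℝ) * ((i : ℝ) + 1) / 2 = ((tri i : ℤ) : ℝ) := by
      have h := two_mul_tri i
      have h' : (2 : ℝ) * (tri i : ℝ) = i * (i + 1) := by exact_mod_cast h
      linarith
    have e2 : 2 * (d : ℝ) + i + 1 = ((2 * d + i + 1 : ℤ) : ℝ) := by push_cast; ring
    have e3 : (2 : ℝ) * (d : ℝ) = ((2 * d : ℤ) : ℝ) := by push_cast; ring
    rw [e1, e2, e3]
    simp only [Real.rpow_intCast]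
    have e4 : qPochInf (q ^ (2 * d + i + 1)) q = qPochInf q q * recipPoch q (i + 2 * d) := by
      rw [recipPoch, mul_div_cancel₀ _ hP, add_comm (i : ℤ)]
    have e5 : q ^ (tri i + 2 * b * (i + d)) = (q ^ b) ^ (2 * d) * q ^ tri i * (q ^ b) ^ (2 * i) := by
      rw [← zpow_natCast (q ^ b), ← zpow_mul, ← zpow_mul, ← zpow_add₀ hq0.ne',
        ← zpow_add₀ hq0.ne']
      push_cast; ring_nf
    simp only [hf]
    rw [e4, div_eq_mul_inv _ (qPoch q q i), one_div_qPoch hq0 hq1, e5, zpow_natCast]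
    field_simp
  have hrhs : ∀ l : ℕ, cosTerm q b l * cosMoment q l d = f (l - d) := by
    intro l
    have h := cosMoment_eq hq0 hq1 l d
    have e0 : cosTerm q b l * cosMoment q l d =
        (-1) ^ l * q ^ ((l : ℤ) * (l + 1) + 2 * b * l) *
          (recipPoch q (2 * l) * cosMoment q l d) := by
      unfold cosTerm
      ring
    have e1 : q ^ (tri (l - d) + 2 * b * (l - d + d)) = q ^ ((l : ℤ) * (l + 1) + 2 * b * l) *
        q ^ (-((l : ℤ) * (l + 1))) * q ^ tri (l - d) := by
      rw [← zpow_add₀ hq0.ne', ← zpow_add₀ hq0.ne']; ring_nf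
    have e2 : (-1 : ℝ) ^ ((l : ℤ) - d) = (-1) ^ l * (-1) ^ d := by
      rw [zpow_sub₀ hm, zpow_natCast, div_eq_mul_inv, ← inv_zpow]
      norm_num
    rw [e0, h]
    simp only [hf]
    rw [e1, e2, show (l : ℤ) - d + 2 * d = l + d by ring]
    ring
  have hi1 : Function.Injective fun i : ℕ => (i : ℤ) := Nat.cast_injective
  have hi2 : Function.Injective fun l : ℕ => (l : ℤ) - d := fun a b h => by
    simp only at h
    omega
  simp only [hrhs]
  rw [hlhs, hi1.tsum_eq, hi2.tsum_eq]
  · intro i hi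
    by_contra hcon
    refine hi ?_
    have h : i < 0 ∨ i + 2 * d < 0 := by
      by_contra! h
      exact hcon ⟨(i + d).toNat, by simp only; omega⟩
    simp only [hf]
    rcases h with h | h <;> rw [recipPoch_of_neg hq0 hq1 h] <;> simp
  · intro i hi
    by_contra hcon
    refine hi ?_
    have h : i < 0 := by
      by_contra! h
      exact hcon ⟨i.toNat, by simp only; omega⟩
    simp only [hf]
    rw [recipPoch_of_neg hq0 hq1 h]
    simp

lemma tsum_normCos_mul_normCos_mul_qCos (hq0 : 0 < q) (hq1 : q < 1) (m r k : ℤ) :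
    ∑' n : ℤ, q ^ n * (normCos q (n + m) * normCos q (n + r)) * qCos q (n + k) =
      q ^ (-m) * ∑' l : ℕ, cosTerm q (k - m) l * cosMoment q l (r - m) := by
  have hsum := summable_normCos_mul_normCos_mul_cosTerm hq0 hq1 m r k
  set F : ℤ → ℕ → ℝ := fun n l =>
    q ^ n * (normCos q (n + m) * normCos q (n + r)) * cosTerm q (n + k) l with hF
  have hFsum : Summable (Function.uncurry F) := hsum
  have hl : ∀ n : ℤ, q ^ n * (normCos q (n + m) * normCos q (n + r)) * qCos q (n + k)
      = ∑' l, F n l := fun n => by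
    simp only [hF]
    rw [tsum_mul_left, qCos]
  simp only [hl]
  rw [← hFsum.tsum_comm, ← tsum_mul_left]
  refine tsum_congr fun l => ?_
  rw [cosMoment, ← tsum_mul_left, ← tsum_mul_left, ← (Equiv.subRight m).tsum_eq]
  refine tsum_congr fun n => ?_
  simp only [hF, Equiv.subRight_apply]
  rw [show n - m + k = n + (k - m) by ring, cosTerm_add hq0, sub_add_cancel,
    show n - m + r = n + (r - m) by ring, show (2 * (l : ℤ) + 1) * n = n + 2 * l * n by ring,
    zpow_add₀ hq0.ne', sub_eq_add_neg n m, zpow_add₀ hq0.ne']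
  ring

end Moments

/-- explicit formula for the kernel `D_{-1/2}` (with base-`q`
Hahn–Exton q-Bessel function on the right). -/
theorem stmt11 (q : ℝ) (hq0 : 0 < q) (hq1 : q < 1) (m r k : ℤ) :
    Dker q (-(1 / 2)) (q ^ (m : ℤ)) (q ^ (r : ℤ)) (q ^ (k : ℤ)) =
      (1 / (1 - q)) * q ^ (-m : ℤ) *
        JHE q (2 * ((r : ℝ) - (m : ℝ))) (q ^ ((k : ℝ) - (m : ℝ))) := by
  have hcongr : ∀ n : ℤ, q ^ n * (jHE q (-(1 / 2)) (q ^ m * q ^ n) *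
      jHE q (-(1 / 2)) (q ^ r * q ^ n) * jHE q (-(1 / 2)) (q ^ k * q ^ n) *
      (q ^ n) ^ (2 * (-(1 / 2)) + 1 : ℝ)) =
      q ^ n * (qCos q (n + m) * qCos q (n + r)) * qCos q (n + k) := by
    intro n
    rw [show (2 : ℝ) * (-(1 / 2)) + 1 = 0 by norm_num, Real.rpow_zero]
    simp only [← zpow_add₀ hq0.ne', jHE_eq_qCos hq0 hq1, add_comm _ n]
    ring
  have h := tsum_normCos_mul_normCos_mul_qCos hq0 hq1 m r k
  simp only [← normCos_eq hq0 hq1] at h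
  have hc : cqv q (-(1 / 2)) =
      (1 / (1 - q)) * (qPochInf q (q ^ 2) / qPochInf (q ^ 2) (q ^ 2)) := by
    rw [cqv, show (2 : ℝ) * (-(1 / 2)) + 2 = 1 by norm_num, Real.rpow_one, mul_div_assoc]
  have hJ := JHE_even_order hq0 hq1 (r - m) (k - m)
  push_cast at hJ
  unfold Dker jackson
  simp only [hcongr]
  rw [hJ, mul_assoc (1 / (1 - q)), ← h, hc]
  have h1 : 1 - q ≠ 0 := by linarith
  generalize qPochInf q (q ^ 2) / qPochInf (q ^ 2) (q ^ 2) = A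
  rw [← tsum_mul_left, ← tsum_mul_left, ← tsum_mul_left]
  refine tsum_congr fun n => ?_
  field_simp
end
end
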